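/- arXiv:1203.2723 — 5 statements merged into one kernel-verified Lean document; each statement's English description precedes it below -/
import Mathlib

section
/- There exists n₀ such that for all n ≥ n₀: if G is a simple graph on n vertices with independence number at most 3 and t₃(G) = f(n,3,4), then the vertex set of G can be partitioned into three sets C₁, C₂, C₃ of sizes ⌊n/3⌋, ⌊(n+1)/3⌋, ⌊(n+2)/3⌋, each of which is a clique in G. -/
/-- `G` has no independent set with more than `m` vertices, i.e. α(G) ≤ m. -/
def IndepBound {V : Type*} (G : SimpleGraph V) (m : ℕ) : Prop :=
  ∀ s : Finset V, (∀ u ∈ s, ∀ v ∈ s, u ≠ v → ¬ G.Adj u v) → s.card ≤ m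

/-- the number of `k`-cliques of `G`. -/
noncomputable def cliqueCount {V : Type*} [Fintype V] (G : SimpleGraph V) (k : ℕ) : ℕ :=
  Nat.card {s : Finset V // s.card = k ∧ G.IsClique (s : Set V)}

/-- `f(n,k,l)`: the minimum number of `k`-cliques over graphs on `n` vertices with
independence number at most `l − 1`. -/
noncomputable def minCliques (n k l : ℕ) : ℕ :=
  sInf {m | ∃ G : SimpleGraph (Fin n), IndepBound G (l - 1) ∧ cliqueCount G k = m}

namespace TriangleMinimization

/-- The quadratic form attached to the type of an isolated vertex and an edge, polarised. -/
def formA (p1 p2 q1 q2 : ℤ) : ℤ :=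
  p1 * (682992 * q1 - 1342656 * q2) +
    p2 * (-1342656 * q1 + 3186864 * q2)

/-- The quadratic form attached to the type of a path on three vertices, polarised. -/
def formC (p1 p2 p3 q1 q2 q3 : ℤ) : ℤ :=
  p1 * (473904 * q1 + 73008 * q2 - 1758672 * q3) +
    p2 * (73008 * q1 + 15984 * q2 - 264384 * q3) +
    p3 * (-1758672 * q1 - 264384 * q2 + 6559920 * q3)

/-- The quadratic form attached to the one-vertex type, polarised. -/
def formO (p1 p2 p3 p4 p5 q1 q2 q3 q4 q5 : ℤ) : ℤ :=
  p1 * (25330 * q1 - 45079 * q2 + 26843 * q3 - 34012 * q4 - 61204 * q5) +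
    p2 * (-45079 * q1 + 181108 * q2 - 79675 * q3 + 83339 * q4 + 127391 * q5) +
    p3 * (26843 * q1 - 79675 * q2 + 40388 * q3 - 47449 * q4 - 74870 * q5) +
    p4 * (-34012 * q1 + 83339 * q2 - 47449 * q3 + 60438 * q4 + 95832 * q5) +
    p5 * (-61204 * q1 + 127391 * q2 - 74870 * q3 + 95832 * q4 + 160712 * q5)

/-- A Boolean as the integer `0` or `1`. -/
def bit (b : Bool) : ℤ := cond b 1 0

/-- `formO` on the flags given by two pairs of vertices over a common root; `a`, `b` are the
adjacencies to the root and `e` the adjacency inside the pair. -/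
def flagO (a b e a' b' e' : Bool) : ℤ :=
  formO (9 * bit a * bit b - 1) (3 * bit e - 1) (9 * bit e * (bit a + bit b) - 2)
    (9 * bit e * bit a * bit b - 1) (3 * (bit a + bit b) - 2)
    (9 * bit a' * bit b' - 1) (3 * bit e' - 1) (9 * bit e' * (bit a' + bit b') - 2)
    (9 * bit e' * bit a' * bit b' - 1) (3 * (bit a' + bit b') - 2)

/-- `formA` on the flags given by two vertices, with adjacencies `a`, `b`, `c` to the roots. -/
def flagA (a b c a' b' c' : Bool) : ℤ :=
  formA (bit b - bit c) ((bit b - bit c) * bit a) (bit b' - bit c') ((bit b' - bit c') * bit a')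

/-- `formC` on the flags given by two vertices, with adjacencies `a`, `b`, `c` to the roots. -/
def flagC (a b c a' b' c' : Bool) : ℤ :=
  formC (3 * (bit b + bit c) - 2) (3 * bit a - 1) (bit b * bit c)
    (3 * (bit b' + bit c') - 2) (3 * bit a' - 1) (bit b' * bit c')

/-- The certificate polynomial in the adjacencies of the vertices `x, y, z, w, v`. -/
def flagP (xy xz xw xv yz yw yv zw zv wv : Bool) : ℤ :=
  328320 * (9 * bit xy * bit xz * bit yz - 1) - 9 * flagO xy xz yz xw xv wv -
    9 * ((1 - bit xy) * (1 - bit xz) * bit yz) * flagA xw yw zw xv yv zv -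
    9 * (bit xy * bit xz * (1 - bit yz)) * flagC xw yw zw xv yv zv

/-- The certificate polynomial summed over 30 relabellings of the five vertices. -/
def flagSum (b01 b02 b03 b04 b12 b13 b14 b23 b24 b34 : Bool) : ℤ :=
  flagP b01 b02 b03 b04 b12 b13 b14 b23 b24 b34 +
    flagP b01 b03 b02 b04 b13 b12 b14 b23 b34 b24 +
    flagP b01 b04 b02 b03 b14 b12 b13 b24 b34 b23 +
    flagP b02 b03 b01 b04 b23 b12 b24 b13 b34 b14 +
    flagP b02 b04 b01 b03 b24 b12 b23 b14 b34 b13 +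
    flagP b03 b04 b01 b02 b34 b13 b23 b14 b24 b12 +
    flagP b01 b12 b13 b14 b02 b03 b04 b23 b24 b34 +
    flagP b01 b13 b12 b14 b03 b02 b04 b23 b34 b24 +
    flagP b01 b14 b12 b13 b04 b02 b03 b24 b34 b23 +
    flagP b12 b13 b01 b14 b23 b02 b24 b03 b34 b04 +
    flagP b12 b14 b01 b13 b24 b02 b23 b04 b34 b03 +
    flagP b13 b14 b01 b12 b34 b03 b23 b04 b24 b02 +
    flagP b02 b12 b23 b24 b01 b03 b04 b13 b14 b34 +
    flagP b02 b23 b12 b24 b03 b01 b04 b13 b34 b14 +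
    flagP b02 b24 b12 b23 b04 b01 b03 b14 b34 b13 +
    flagP b12 b23 b02 b24 b13 b01 b14 b03 b34 b04 +
    flagP b12 b24 b02 b23 b14 b01 b13 b04 b34 b03 +
    flagP b23 b24 b02 b12 b34 b03 b13 b04 b14 b01 +
    flagP b03 b13 b23 b34 b01 b02 b04 b12 b14 b24 +
    flagP b03 b23 b13 b34 b02 b01 b04 b12 b24 b14 +
    flagP b03 b34 b13 b23 b04 b01 b02 b14 b24 b12 +
    flagP b13 b23 b03 b34 b12 b01 b14 b02 b24 b04 +
    flagP b13 b34 b03 b23 b14 b01 b12 b04 b24 b02 +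
    flagP b23 b34 b03 b13 b24 b02 b12 b04 b14 b01 +
    flagP b04 b14 b24 b34 b01 b02 b03 b12 b13 b23 +
    flagP b04 b24 b14 b34 b02 b01 b03 b12 b23 b13 +
    flagP b04 b34 b14 b24 b03 b01 b02 b13 b23 b12 +
    flagP b14 b24 b04 b34 b12 b01 b13 b02 b23 b03 +
    flagP b14 b34 b04 b24 b13 b01 b12 b03 b23 b02 +
    flagP b24 b34 b04 b14 b23 b02 b12 b03 b13 b01

/-- No four of the five vertices are independent. -/
def noIndepFour (b01 b02 b03 b04 b12 b13 b14 b23 b24 b34 : Bool) : Bool :=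
  (b01 || b02 || b03 || b12 || b13 || b23) &&
    (b01 || b02 || b04 || b12 || b14 || b24) &&
    (b01 || b03 || b04 || b13 || b14 || b34) &&
    (b02 || b03 || b04 || b23 || b24 || b34) &&
    (b12 || b13 || b14 || b23 || b24 || b34)

/-- Conjunction over both Boolean values. -/
def allBool (p : Bool → Bool) : Bool := p true && p false

/-- `flagSum` is nonnegative on every graph without an independent set of size four. -/
def flagCheck : Bool :=
  allBool fun b01 =>
  allBool fun b02 =>
  allBool fun b03 =>
  allBool fun b04 =>
  allBool fun b12 =>
  allBool fun b13 =>
  allBool fun b14 =>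
  allBool fun b23 =>
  allBool fun b24 =>
  allBool fun b34 =>
  !noIndepFour b01 b02 b03 b04 b12 b13 b14 b23 b24 b34 ||
    decide (0 ≤ flagSum b01 b02 b03 b04 b12 b13 b14 b23 b24 b34)

theorem flagCheck_eq_true : flagCheck = true := by decide +kernel

theorem allBool_apply {p : Bool → Bool} (h : allBool p = true) (b : Bool) : p b = true := by
  cases b <;> simp_all [allBool]

theorem flagSum_nonneg (b01 b02 b03 b04 b12 b13 b14 b23 b24 b34 : Bool)
    (h : noIndepFour b01 b02 b03 b04 b12 b13 b14 b23 b24 b34 = true) :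
    0 ≤ flagSum b01 b02 b03 b04 b12 b13 b14 b23 b24 b34 := by
  have key := flagCheck_eq_true
  unfold flagCheck at key
  replace key := allBool_apply key b01
  replace key := allBool_apply key b02
  replace key := allBool_apply key b03
  replace key := allBool_apply key b04
  replace key := allBool_apply key b12
  replace key := allBool_apply key b13
  replace key := allBool_apply key b14
  replace key := allBool_apply key b23
  replace key := allBool_apply key b24
  replace key := allBool_apply key b34
  simpa [h] using key
theorem formA_self_nonneg (p₁ p₂ : ℤ) : 0 ≤ formA p₁ p₂ p₁ p₂ := by
  have h : ((formA p₁ p₂ p₁ p₂ : ℤ) : ℚ) =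
      682992 * (p₁ - 1036 / 527 * p₂) ^ 2 + 288485712 / 527 * (p₂ : ℚ) ^ 2 := by
    simp only [formA]
    push_cast
    ring
  have h' : (0 : ℚ) ≤ (formA p₁ p₂ p₁ p₂ : ℤ) := by
    rw [h]
    positivity
  exact_mod_cast h'

theorem formC_self_nonneg (p₁ p₂ p₃ : ℤ) : 0 ≤ formC p₁ p₂ p₃ p₁ p₂ p₃ := by
  have h : ((formC p₁ p₂ p₃ p₁ p₂ p₃ : ℤ) : ℚ) =
      473904 * (p₁ + (169 * p₂ - 4071 * p₃) / 1097) ^ 2 +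
        5196096 / 1097 * (p₂ + 16635 / 12028 * p₃) ^ 2 + 73296468 / 3007 * (p₃ : ℚ) ^ 2 := by
    simp only [formC]
    push_cast
    ring
  have h' : (0 : ℚ) ≤ (formC p₁ p₂ p₃ p₁ p₂ p₃ : ℤ) := by
    rw [h]
    positivity
  exact_mod_cast h'

theorem formO_self_ge (p₁ p₂ p₃ p₄ p₅ : ℤ) :
    48 * p₅ ^ 2 ≤ formO p₁ p₂ p₃ p₄ p₅ p₁ p₂ p₃ p₄ p₅ := by
  have h : ((formO p₁ p₂ p₃ p₄ p₅ p₁ p₂ p₃ p₄ p₅ : ℤ) : ℚ) =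
      25330 * (p₁ + (-45079 * p₂ + 26843 * p₃ - 34012 * p₄ - 61204 * p₅) / 25330) ^ 2 +
        2555349399 / 25330 *
          (p₂ + (-808112153 * p₃ + 577749922 * p₄ + 467798914 * p₅) / 2555349399) ^ 2 +
        4733532920420 / 2555349399 *
          (p₃ + (-10712644715656 * p₄ - 10655176566631 * p₅) / 4733532920420) ^ 2 +
        146265903661664 / 1183383230105 * (p₄ + 2788528596169 / 9141618978854 * p₅) ^ 2 +
        884615395279003 / 18283237957708 * (p₅ : ℚ) ^ 2 := by
    simp only [formO]
    push_cast
    ring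
  have h' : (48 : ℚ) * (p₅ : ℚ) ^ 2 ≤ (formO p₁ p₂ p₃ p₄ p₅ p₁ p₂ p₃ p₄ p₅ : ℤ) := by
    rw [h]
    have : (48 : ℚ) * (p₅ : ℚ) ^ 2 ≤ 884615395279003 / 18283237957708 * (p₅ : ℚ) ^ 2 := by
      gcongr
      norm_num
    have h₂ : ∀ a b c d e : ℚ, 0 ≤ a → 0 ≤ b → 0 ≤ c → 0 ≤ d → 48 * (p₅ : ℚ) ^ 2 ≤ e →
        48 * (p₅ : ℚ) ^ 2 ≤ a + b + c + d + e := by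
      intros
      linarith
    exact h₂ _ _ _ _ _ (by positivity) (by positivity) (by positivity) (by positivity) this
  exact_mod_cast h'

theorem formA_sum_sum {ι : Type*} [Fintype ι] (p₁ p₂ : ι → ℤ) :
    ∑ i, ∑ j, formA (p₁ i) (p₂ i)
      (p₁ j) (p₂ j) =
    formA (∑ i, p₁ i) (∑ i, p₂ i)
      (∑ i, p₁ i) (∑ i, p₂ i) := by
  simp only [formA, Finset.sum_mul, Finset.mul_sum, ← Finset.sum_add_distrib,
    ← Finset.sum_sub_distrib]
  exact Finset.sum_comm

theorem formC_sum_sum {ι : Type*} [Fintype ι] (p₁ p₂ p₃ : ι → ℤ) :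
    ∑ i, ∑ j, formC (p₁ i) (p₂ i) (p₃ i)
      (p₁ j) (p₂ j) (p₃ j) =
    formC (∑ i, p₁ i) (∑ i, p₂ i) (∑ i, p₃ i)
      (∑ i, p₁ i) (∑ i, p₂ i) (∑ i, p₃ i) := by
  simp only [formC, Finset.sum_mul, Finset.mul_sum, ← Finset.sum_add_distrib,
    ← Finset.sum_sub_distrib]
  exact Finset.sum_comm

theorem formO_sum_sum {ι : Type*} [Fintype ι] (p₁ p₂ p₃ p₄ p₅ : ι → ℤ) :
    ∑ i, ∑ j, formO (p₁ i) (p₂ i) (p₃ i) (p₄ i) (p₅ i)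
      (p₁ j) (p₂ j) (p₃ j) (p₄ j) (p₅ j) =
    formO (∑ i, p₁ i) (∑ i, p₂ i) (∑ i, p₃ i) (∑ i, p₄ i) (∑ i, p₅ i)
      (∑ i, p₁ i) (∑ i, p₂ i) (∑ i, p₃ i) (∑ i, p₄ i) (∑ i, p₅ i) := by
  simp only [formO, Finset.sum_mul, Finset.mul_sum, ← Finset.sum_add_distrib,
    ← Finset.sum_sub_distrib]
  exact Finset.sum_comm

section Counting

variable {V : Type*}

/-- The certificate polynomial evaluated on the closed adjacencies of a tuple of five vertices. -/
def flagAt (A : V → V → Bool) (f : Fin 5 → V) : ℤ :=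
  flagP (A (f 0) (f 1)) (A (f 0) (f 2)) (A (f 0) (f 3)) (A (f 0) (f 4)) (A (f 1) (f 2))
    (A (f 1) (f 3)) (A (f 1) (f 4)) (A (f 2) (f 3)) (A (f 2) (f 4)) (A (f 3) (f 4))

/-- Representatives of the labellings of five vertices by a root, an unordered pair and
the complementary unordered pair. -/
def flagLabellings : List (Fin 5 → Fin 5) :=
  [![0, 1, 2, 3, 4], ![0, 1, 3, 2, 4], ![0, 1, 4, 2, 3], ![0, 2, 3, 1, 4], ![0, 2, 4, 1, 3],
   ![0, 3, 4, 1, 2], ![1, 0, 2, 3, 4], ![1, 0, 3, 2, 4], ![1, 0, 4, 2, 3], ![1, 2, 3, 0, 4],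
   ![1, 2, 4, 0, 3], ![1, 3, 4, 0, 2], ![2, 0, 1, 3, 4], ![2, 0, 3, 1, 4], ![2, 0, 4, 1, 3],
   ![2, 1, 3, 0, 4], ![2, 1, 4, 0, 3], ![2, 3, 4, 0, 1], ![3, 0, 1, 2, 4], ![3, 0, 2, 1, 4],
   ![3, 0, 4, 1, 2], ![3, 1, 2, 0, 4], ![3, 1, 4, 0, 2], ![3, 2, 4, 0, 1], ![4, 0, 1, 2, 3],
   ![4, 0, 2, 1, 3], ![4, 0, 3, 1, 2], ![4, 1, 2, 0, 3], ![4, 1, 3, 0, 2], ![4, 2, 3, 0, 1]]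

theorem flagSum_eq_sum_flagAt (A : V → V → Bool) (hA : ∀ x y, A x y = A y x) (f : Fin 5 → V) :
    flagSum (A (f 0) (f 1)) (A (f 0) (f 2)) (A (f 0) (f 3)) (A (f 0) (f 4)) (A (f 1) (f 2))
      (A (f 1) (f 3)) (A (f 1) (f 4)) (A (f 2) (f 3)) (A (f 2) (f 4)) (A (f 3) (f 4)) =
      (flagLabellings.map fun s => flagAt A (f ∘ s)).sum := by
  simp only [flagLabellings, List.map_cons, List.map_nil, List.sum_cons, List.sum_nil, flagAt,
    Function.comp, Matrix.cons_val]
  simp only [flagSum, hA (f 1) (f 0), hA (f 2) (f 0), hA (f 3) (f 0), hA (f 4) (f 0),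
      hA (f 2) (f 1), hA (f 3) (f 1), hA (f 4) (f 1), hA (f 3) (f 2), hA (f 4) (f 2),
      hA (f 4) (f 3)]
  ring

theorem flagLabellings_bijective : ∀ s ∈ flagLabellings, s.Bijective := by
  simp only [Function.Bijective, Function.Injective, Function.Surjective]
  decide +kernel

theorem length_flagLabellings : flagLabellings.length = 30 := rfl

variable [Fintype V]

theorem sum_fin_succ_pi {n : ℕ} (F : (Fin (n + 1) → V) → ℤ) :
    ∑ f, F f = ∑ x, ∑ g : Fin n → V, F (Fin.cons x g) := by
  rw [← Fintype.sum_prod_type']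
  exact (Fintype.sum_equiv (Fin.consEquiv fun _ => V) _ _ fun _ => rfl).symm

theorem sum_fin_five_pi (F : V → V → V → V → V → ℤ) :
    ∑ f : Fin 5 → V, F (f 0) (f 1) (f 2) (f 3) (f 4) =
      ∑ x, ∑ y, ∑ z, ∑ w, ∑ v, F x y z w v := by
  simp only [sum_fin_succ_pi, Fintype.sum_unique]
  rfl

theorem sum_flagAt_comp (A : V → V → Bool) {s : Fin 5 → Fin 5} (hs : s.Bijective) :
    ∑ f, flagAt A (f ∘ s) = ∑ f, flagAt A f :=
  Fintype.sum_equiv (Equiv.arrowCongr (Equiv.ofBijective s hs).symm (Equiv.refl V)) _ _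
    fun _ => rfl

theorem sum_labellings_flagAt (A : V → V → Bool) (l : List (Fin 5 → Fin 5))
    (hl : ∀ s ∈ l, s.Bijective) :
    ∑ f, (l.map fun s => flagAt A (f ∘ s)).sum = l.length * ∑ f, flagAt A f := by
  induction l with
  | nil => simp
  | cons s l ih =>
    simp only [List.map_cons, List.sum_cons, Finset.sum_add_distrib, List.length_cons,
      sum_flagAt_comp A (hl s List.mem_cons_self), ih fun t ht => hl t (List.mem_cons_of_mem s ht)]
    push_cast
    ring

theorem sum_flagAt_nonneg (A : V → V → Bool) (hA : ∀ x y, A x y = A y x)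
    (hind : ∀ x y z w, (A x y || A x z || A x w || A y z || A y w || A z w) = true) :
    0 ≤ ∑ f, flagAt A f := by
  have key := sum_labellings_flagAt A flagLabellings flagLabellings_bijective
  rw [length_flagLabellings] at key
  have : 0 ≤ ∑ f, (flagLabellings.map fun s => flagAt A (f ∘ s)).sum := by
    refine Finset.sum_nonneg fun f _ => ?_
    rw [← flagSum_eq_sum_flagAt A hA]
    refine flagSum_nonneg _ _ _ _ _ _ _ _ _ _ ?_
    simp only [noIndepFour, hind, Bool.and_self]
  push_cast at key
  omega

/-- Number of ordered triples (with repetition) of pairwise equal or adjacent vertices. -/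
def tripleSum (A : V → V → Bool) : ℤ :=
  ∑ x, ∑ y, ∑ z, bit (A x y) * bit (A x z) * bit (A y z)

theorem bit_nonneg (b : Bool) : 0 ≤ bit b := by cases b <;> simp [bit]

theorem one_sub_bit_nonneg (b : Bool) : 0 ≤ 1 - bit b := by cases b <;> simp [bit]

theorem sum_flagO_ge (A : V → V → Bool) (x : V) :
    48 * ((Fintype.card V : ℤ) * (6 * ∑ y, bit (A x y) - 2 * Fintype.card V)) ^ 2 ≤
      ∑ y, ∑ z, ∑ w, ∑ v, flagO (A x y) (A x z) (A y z) (A x w) (A x v) (A w v) := by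
  have h := formO_sum_sum (ι := V × V) (fun i => 9 * bit (A x i.1) * bit (A x i.2) - 1)
    (fun i => 3 * bit (A i.1 i.2) - 1)
    (fun i => 9 * bit (A i.1 i.2) * (bit (A x i.1) + bit (A x i.2)) - 2)
    (fun i => 9 * bit (A i.1 i.2) * bit (A x i.1) * bit (A x i.2) - 1)
    (fun i => 3 * (bit (A x i.1) + bit (A x i.2)) - 2)
  have h₅ : ∑ i : V × V, (3 * (bit (A x i.1) + bit (A x i.2)) - 2) =
      (Fintype.card V : ℤ) * (6 * ∑ y, bit (A x y) - 2 * Fintype.card V) := by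
    simp only [Fintype.sum_prod_type, Finset.sum_sub_distrib, ← Finset.mul_sum,
      Finset.sum_add_distrib, Finset.sum_const, Finset.card_univ, nsmul_eq_mul,
      Fintype.card_prod]
    push_cast
    ring
  have h' := formO_self_ge (∑ i : V × V, (9 * bit (A x i.1) * bit (A x i.2) - 1))
    (∑ i : V × V, (3 * bit (A i.1 i.2) - 1))
    (∑ i : V × V, (9 * bit (A i.1 i.2) * (bit (A x i.1) + bit (A x i.2)) - 2))
    (∑ i : V × V, (9 * bit (A i.1 i.2) * bit (A x i.1) * bit (A x i.2) - 1))
    (∑ i : V × V, (3 * (bit (A x i.1) + bit (A x i.2)) - 2))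
  rw [← h, h₅] at h'
  simpa only [Fintype.sum_prod_type, flagO] using h'

theorem sum_flagA_nonneg (A : V → V → Bool) (x y z : V) :
    0 ≤ ∑ w, ∑ v, flagA (A x w) (A y w) (A z w) (A x v) (A y v) (A z v) := by
  simp only [flagA]
  rw [formA_sum_sum (fun w => bit (A y w) - bit (A z w))
    (fun w => (bit (A y w) - bit (A z w)) * bit (A x w))]
  exact formA_self_nonneg _ _

theorem sum_flagC_nonneg (A : V → V → Bool) (x y z : V) :
    0 ≤ ∑ w, ∑ v, flagC (A x w) (A y w) (A z w) (A x v) (A y v) (A z v) := by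
  simp only [flagC]
  rw [formC_sum_sum (fun w => 3 * (bit (A y w) + bit (A z w)) - 2)
    (fun w => 3 * bit (A x w) - 1) (fun w => bit (A y w) * bit (A z w))]
  exact formC_self_nonneg _ _ _

/-- A stability form of the asymptotic lower bound `n ^ 3 / 9` for the number of ordered
triangles in a graph without independent sets of size four. -/
theorem sum_degree_deviation_le [Nonempty V] (A : V → V → Bool) (hA : ∀ x y, A x y = A y x)
    (hind : ∀ x y z w, (A x y || A x z || A x w || A y z || A y w || A z w) = true) :
    432 * ∑ x, (6 * ∑ y, bit (A x y) - 2 * (Fintype.card V : ℤ)) ^ 2 ≤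
      328320 * (9 * tripleSum A - (Fintype.card V : ℤ) ^ 3) := by
  have h := sum_flagAt_nonneg A hA hind
  simp only [flagAt] at h
  rw [sum_fin_five_pi (fun x y z w v => flagP (A x y) (A x z) (A x w) (A x v) (A y z) (A y w)
    (A y v) (A z w) (A z v) (A w v))] at h
  simp only [flagP, Finset.sum_sub_distrib] at h
  have h₁ : ∑ x : V, ∑ y : V, ∑ z : V, ∑ _w : V, ∑ _v : V,
      328320 * (9 * bit (A x y) * bit (A x z) * bit (A y z) - 1) =
      328320 * (Fintype.card V : ℤ) ^ 2 * (9 * tripleSum A - (Fintype.card V : ℤ) ^ 3) := by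
    simp only [tripleSum, Finset.sum_const, Finset.card_univ, nsmul_eq_mul, mul_sub, mul_one,
      Finset.sum_sub_distrib, Finset.mul_sum]
    congr 1
    · refine Finset.sum_congr rfl fun x _ => Finset.sum_congr rfl fun y _ =>
        Finset.sum_congr rfl fun z _ => ?_
      ring
    · ring
  have h₂ : 48 * (Fintype.card V : ℤ) ^ 2 *
      ∑ x, (6 * ∑ y, bit (A x y) - 2 * (Fintype.card V : ℤ)) ^ 2 ≤
      ∑ x, ∑ y, ∑ z, ∑ w, ∑ v, flagO (A x y) (A x z) (A y z) (A x w) (A x v) (A w v) := by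
    rw [Finset.mul_sum]
    refine Finset.sum_le_sum fun x _ => le_trans (le_of_eq ?_) (sum_flagO_ge A x)
    ring
  have h₃ : 0 ≤ ∑ x : V, ∑ y : V, ∑ z : V, ∑ w : V, ∑ v : V,
      9 * ((1 - bit (A x y)) * (1 - bit (A x z)) * bit (A y z)) *
        flagA (A x w) (A y w) (A z w) (A x v) (A y v) (A z v) := by
    refine Finset.sum_nonneg fun x _ => Finset.sum_nonneg fun y _ =>
      Finset.sum_nonneg fun z _ => ?_
    simp only [← Finset.mul_sum]
    have := one_sub_bit_nonneg (A x y)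
    have := one_sub_bit_nonneg (A x z)
    have := bit_nonneg (A y z)
    have := sum_flagA_nonneg A x y z
    positivity
  have h₄ : 0 ≤ ∑ x : V, ∑ y : V, ∑ z : V, ∑ w : V, ∑ v : V,
      9 * (bit (A x y) * bit (A x z) * (1 - bit (A y z))) *
        flagC (A x w) (A y w) (A z w) (A x v) (A y v) (A z v) := by
    refine Finset.sum_nonneg fun x _ => Finset.sum_nonneg fun y _ =>
      Finset.sum_nonneg fun z _ => ?_
    simp only [← Finset.mul_sum]
    have := bit_nonneg (A x y)
    have := bit_nonneg (A x z)
    have := one_sub_bit_nonneg (A y z)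
    have := sum_flagC_nonneg A x y z
    positivity
  simp only [← Finset.mul_sum] at h h₁ h₂ h₃ h₄
  have hn : (0 : ℤ) < (Fintype.card V : ℤ) ^ 2 := by
    have := Fintype.card_pos (α := V)
    positivity
  refine le_of_mul_le_mul_left ?_ hn
  simp only [Finset.sum_sub_distrib, ← Finset.mul_sum] at h h₁ h₂ h₃ h₄ ⊢
  nlinarith [h, h₁, h₂, h₃, h₄]

end Counting

section Triangles

open scoped Classical

variable {V : Type*} {G : SimpleGraph V}

/-- Adjacency or equality, as a Boolean relation. -/
noncomputable def closedAdj (G : SimpleGraph V) (x y : V) : Bool := decide (x = y ∨ G.Adj x y)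

theorem closedAdj_iff {x y : V} : closedAdj G x y = true ↔ x = y ∨ G.Adj x y := by
  simp [closedAdj]

theorem closedAdj_comm (x y : V) : closedAdj G x y = closedAdj G y x := by
  simp only [closedAdj, eq_comm, G.adj_comm]

theorem closedAdj_self (x : V) : closedAdj G x x = true := by simp [closedAdj]

theorem closedAdj_of_indepBound (hG : IndepBound G 3) (x y z w : V) :
    closedAdj G x y = true ∨ closedAdj G x z = true ∨ closedAdj G x w = true ∨
      closedAdj G y z = true ∨ closedAdj G y w = true ∨ closedAdj G z w = true := by
  by_contra! h
  simp only [ne_eq, closedAdj_iff, not_or] at h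
  obtain ⟨⟨hxy, axy⟩, ⟨hxz, axz⟩, ⟨hxw, axw⟩, ⟨hyz, ayz⟩, ⟨hyw, ayw⟩, hzw, azw⟩ := h
  have hle := hG {x, y, z, w} (by
    intro u hu v hv huv
    simp only [Finset.mem_insert, Finset.mem_singleton] at hu hv
    rcases hu with rfl | rfl | rfl | rfl <;> rcases hv with rfl | rfl | rfl | rfl <;>
      first
        | exact absurd rfl huv
        | assumption
        | (rw [G.adj_comm]; assumption))
  rw [Finset.card_insert_of_notMem (by simp [*]), Finset.card_insert_of_notMem (by simp [*]),
    Finset.card_insert_of_notMem (by simp [*]), Finset.card_singleton] at hle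
  omega

variable [Fintype V]

/-- The vertex sets of the triangles of `G`. -/
noncomputable def triangles (G : SimpleGraph V) : Finset (Finset V) :=
  Finset.univ.filter fun s => s.card = 3 ∧ G.IsClique (s : Set V)

/-- Ordered pairs of adjacent neighbours of `u`. -/
noncomputable def link (G : SimpleGraph V) (u : V) : Finset (V × V) :=
  Finset.univ.filter fun p => G.Adj u p.1 ∧ G.Adj u p.2 ∧ G.Adj p.1 p.2

/-- Ordered pairs of equal or adjacent members of the closed neighbourhood of `u`. -/
noncomputable def closedLink (G : SimpleGraph V) (u : V) : Finset (V × V) :=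
  Finset.univ.filter fun p => closedAdj G u p.1 ∧ closedAdj G u p.2 ∧ closedAdj G p.1 p.2

/-- The closed neighbourhood of `u`. -/
noncomputable def closedNbhd (G : SimpleGraph V) (u : V) : Finset V :=
  Finset.univ.filter fun x => closedAdj G u x

theorem mem_triangles {s : Finset V} :
    s ∈ triangles G ↔ s.card = 3 ∧ G.IsClique (s : Set V) := by
  simp [triangles]

theorem mem_link {u : V} {p : V × V} :
    p ∈ link G u ↔ G.Adj u p.1 ∧ G.Adj u p.2 ∧ G.Adj p.1 p.2 := by
  simp [link]

theorem cliqueCount_three (G : SimpleGraph V) : cliqueCount G 3 = (triangles G).card := by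
  rw [cliqueCount, Nat.card_eq_fintype_card, Fintype.card_subtype, triangles]

theorem card_link (G : SimpleGraph V) (u : V) :
    (link G u).card = 2 * ((triangles G).filter (u ∈ ·)).card := by
  have hmaps : ∀ p ∈ link G u, ({u, p.1, p.2} : Finset V) ∈ (triangles G).filter (u ∈ ·) := by
    intro p hp
    obtain ⟨h₁, h₂, h₃⟩ := mem_link.1 hp
    have := G.is3Clique_triple_iff.2 ⟨h₁, h₂, h₃⟩
    simp only [Finset.mem_filter, mem_triangles]
    exact ⟨⟨this.card_eq, this.isClique⟩, by simp⟩
  rw [Finset.card_eq_sum_card_fiberwise hmaps, Finset.sum_const_nat (m := 2), mul_comm]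
  intro b hb
  obtain ⟨hbt, hub⟩ := Finset.mem_filter.1 hb
  obtain ⟨hcard, hcl⟩ := mem_triangles.1 hbt
  have : (link G u).filter (fun p => ({u, p.1, p.2} : Finset V) = b) = (b.erase u).offDiag := by
    ext ⟨y, z⟩
    simp only [Finset.mem_filter, mem_link, Finset.mem_offDiag, Finset.mem_erase]
    constructor
    · rintro ⟨⟨h₁, h₂, h₃⟩, rfl⟩
      simp [h₁.ne', h₂.ne', h₃.ne]
    · rintro ⟨⟨h₁, h₂⟩, ⟨h₃, h₄⟩, h₅⟩
      refine ⟨⟨hcl hub h₂ (Ne.symm h₁), hcl hub h₄ (Ne.symm h₃), hcl h₂ h₄ h₅⟩, ?_⟩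
      apply Finset.eq_of_subset_of_card_le
      · intro w
        simp only [Finset.mem_insert, Finset.mem_singleton]
        rintro (rfl | rfl | rfl) <;> assumption
      · rw [hcard, Finset.card_eq_three.2 ⟨u, y, z, Ne.symm h₁, Ne.symm h₃, h₅, rfl⟩]
  rw [this, Finset.offDiag_card, Finset.card_erase_of_mem hub, hcard]

theorem sum_card_link (G : SimpleGraph V) : ∑ u, (link G u).card = 6 * (triangles G).card := by
  simp only [card_link, ← Finset.mul_sum]
  have : ∑ u, ((triangles G).filter (u ∈ ·)).card = ∑ s ∈ triangles G, s.card := by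
    simp only [Finset.card_filter]
    rw [Finset.sum_comm]
    simp
  rw [this, Finset.sum_const_nat fun s hs => (mem_triangles.1 hs).1]
  ring

theorem card_closedLink_le (G : SimpleGraph V) (u : V) :
    (closedLink G u).card ≤ (link G u).card + 3 * Fintype.card V := by
  have hsub : closedLink G u ⊆ link G u ∪ (Finset.univ.image (fun x => (u, x)) ∪
      (Finset.univ.image (fun x => (x, u)) ∪ Finset.univ.image fun x : V => (x, x))) := by
    rintro ⟨y, z⟩
    simp only [closedLink, Finset.mem_filter, Finset.mem_univ, true_and, closedAdj_iff,
      Finset.mem_union, mem_link, Finset.mem_image, Prod.mk.injEq]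
    rintro ⟨rfl | h₁, h⟩
    · exact Or.inr (Or.inl ⟨z, rfl, rfl⟩)
    rcases h with ⟨rfl | h₂, h⟩
    · exact Or.inr (Or.inr (Or.inl ⟨y, rfl, rfl⟩))
    rcases h with rfl | h₃
    · exact Or.inr (Or.inr (Or.inr ⟨y, rfl, rfl⟩))
    · exact Or.inl ⟨h₁, h₂, h₃⟩
  have himage : ∀ f : V → V × V, (Finset.univ.image f).card ≤ Fintype.card V := fun f =>
    Finset.card_image_le
  have h₀ := Finset.card_le_card hsub
  have h₁ := himage fun x => (u, x)
  have h₂ := himage fun x => (x, u)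
  have h₃ := himage fun x => (x, x)
  have h₄ := Finset.card_union_le (link G u) (Finset.univ.image (fun x => (u, x)) ∪
      (Finset.univ.image (fun x => (x, u)) ∪ Finset.univ.image fun x : V => (x, x)))
  have h₅ := Finset.card_union_le (Finset.univ.image (fun x => (u, x)))
      (Finset.univ.image (fun x => (x, u)) ∪ Finset.univ.image fun x : V => (x, x))
  have h₆ := Finset.card_union_le (Finset.univ.image (fun x => (x, u)))
      (Finset.univ.image fun x : V => (x, x))
  omega

theorem sum_bit_closedAdj (G : SimpleGraph V) (x : V) :
    ∑ y, bit (closedAdj G x y) = (closedNbhd G x).card := by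
  rw [closedNbhd, Finset.card_filter]
  push_cast
  refine Finset.sum_congr rfl fun y _ => ?_
  cases closedAdj G x y <;> simp [bit]

theorem tripleSum_closedAdj (G : SimpleGraph V) :
    tripleSum (closedAdj G) = ∑ x, ((closedLink G x).card : ℤ) := by
  refine Finset.sum_congr rfl fun x _ => ?_
  rw [closedLink, Finset.card_filter, Fintype.sum_prod_type]
  push_cast
  refine Finset.sum_congr rfl fun y _ => Finset.sum_congr rfl fun z _ => ?_
  cases closedAdj G x y <;> cases closedAdj G x z <;> cases closedAdj G y z <;> simp [bit]

theorem tripleSum_closedAdj_le (G : SimpleGraph V) :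
    tripleSum (closedAdj G) ≤ 6 * (triangles G).card + 3 * (Fintype.card V : ℤ) ^ 2 := by
  have h : ∑ x, (closedLink G x).card ≤ ∑ x, ((link G x).card + 3 * Fintype.card V) :=
    Finset.sum_le_sum fun x _ => card_closedLink_le G x
  rw [Finset.sum_add_distrib, sum_card_link, Finset.sum_const, Finset.card_univ, smul_eq_mul] at h
  rw [tripleSum_closedAdj]
  have h' : (∑ x, ((closedLink G x).card : ℤ)) ≤
      6 * (triangles G).card + Fintype.card V * (3 * Fintype.card V) := by
    exact_mod_cast h
  linarith

theorem sum_closedNbhd_deviation_le [Nonempty V] (hG : IndepBound G 3) :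
    432 * ∑ x, (6 * ((closedNbhd G x).card : ℤ) - 2 * (Fintype.card V : ℤ)) ^ 2 ≤
      328320 * (54 * (triangles G).card + 27 * (Fintype.card V : ℤ) ^ 2 -
        (Fintype.card V : ℤ) ^ 3) := by
  have h := sum_degree_deviation_le (closedAdj G) closedAdj_comm (by
    intro x y z w
    simpa only [Bool.or_eq_true, or_assoc] using closedAdj_of_indepBound hG x y z w)
  simp only [sum_bit_closedAdj] at h
  have := tripleSum_closedAdj_le G
  linarith

end Triangles

section Comparison

open scoped Classical

variable {V : Type*}

/-- The graph obtained from `G` by turning `u` into a twin of `v` adjacent to `v`. -/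
def cloneGraph (G : SimpleGraph V) (u v : V) : SimpleGraph V where
  Adj x y := x ≠ y ∧ closedAdj G (Function.update id u v x) (Function.update id u v y) = true
  symm := ⟨fun x y h => ⟨h.1.symm, by rw [closedAdj_comm]; exact h.2⟩⟩
  loopless := ⟨fun x h => h.1 rfl⟩

theorem indepBound_cloneGraph {G : SimpleGraph V} {m : ℕ} (hG : IndepBound G m) (u v : V) :
    IndepBound (cloneGraph G u v) m := by
  intro s hs
  have hs' : ∀ x ∈ s, ∀ y ∈ s, x ≠ y →
      ¬ (Function.update id u v x = Function.update id u v y ∨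
        G.Adj (Function.update id u v x) (Function.update id u v y)) :=
    fun x hx y hy hxy h => hs x hx y hy hxy ⟨hxy, closedAdj_iff.2 h⟩
  have hinj : Set.InjOn (Function.update id u v) (s : Set V) := by
    intro x hx y hy hxy
    by_contra hne
    exact hs' x hx y hy hne (Or.inl hxy)
  rw [← Finset.card_image_of_injOn hinj]
  apply hG
  simp only [Finset.mem_image]
  rintro _ ⟨x, hx, rfl⟩ _ ⟨y, hy, rfl⟩ hxy hadj
  exact hs' x hx y hy (fun h => hxy (by rw [h])) (Or.inr hadj)

/-- The disjoint union of cliques on the fibres of `c`. -/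
def fiberGraph {ι : Type*} (c : V → ι) : SimpleGraph V where
  Adj x y := x ≠ y ∧ c x = c y
  symm := ⟨fun _ _ h => ⟨h.1.symm, h.2.symm⟩⟩
  loopless := ⟨fun _ h => h.1 rfl⟩

theorem indepBound_fiberGraph {ι : Type*} [Fintype ι] (c : V → ι) :
    IndepBound (fiberGraph c) (Fintype.card ι) := by
  intro s hs
  rw [← Finset.card_univ]
  refine Finset.card_le_card_of_injOn c (by simp) fun x hx y hy hxy => ?_
  by_contra hne
  exact hs x hx y hy hne ⟨hne, hxy⟩

variable [Fintype V]

theorem link_cloneGraph_subset (G : SimpleGraph V) (u v : V) :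
    link (cloneGraph G u v) u ⊆ closedLink G v := by
  rintro ⟨y, z⟩ h
  obtain ⟨⟨h₁, h₂⟩, ⟨h₃, h₄⟩, -, h₆⟩ := mem_link.1 h
  simp only [Function.update_self, Function.update_of_ne (Ne.symm h₁),
    Function.update_of_ne (Ne.symm h₃), id] at h₂ h₄ h₆
  simp [closedLink, h₂, h₄, h₆]

/-- In a graph minimising the number of triangles, no vertex lies in many more triangles than
another one: otherwise cloning the latter would be an improvement. -/
theorem card_link_le_of_minimal {G : SimpleGraph V} (hG : IndepBound G 3)
    (hmin : ∀ H : SimpleGraph V, IndepBound H 3 → (triangles G).card ≤ (triangles H).card)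
    (u v : V) : (link G u).card ≤ (link G v).card + 3 * Fintype.card V := by
  have h₁ := hmin _ (indepBound_cloneGraph hG u v)
  have h₂ := Finset.card_filter_add_card_filter_not (s := triangles G) (u ∈ ·)
  have h₃ := Finset.card_filter_add_card_filter_not (s := triangles (cloneGraph G u v)) (u ∈ ·)
  have h₄ := Finset.card_le_card (link_cloneGraph_subset G u v)
  have h₅ := card_closedLink_le G v
  have h₆ : ((triangles (cloneGraph G u v)).filter (u ∉ ·)).card ≤
      ((triangles G).filter (u ∉ ·)).card := by
    apply Finset.card_le_card
    intro s hs
    simp only [Finset.mem_filter, mem_triangles] at hs ⊢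
    refine ⟨⟨hs.1.1, fun x hx y hy hxy => ?_⟩, hs.2⟩
    have hxu : x ≠ u := fun h => hs.2 (h ▸ hx)
    have hyu : y ≠ u := fun h => hs.2 (h ▸ hy)
    have := (hs.1.2 hx hy hxy).2
    rw [Function.update_of_ne hxu, Function.update_of_ne hyu, closedAdj_iff] at this
    exact this.resolve_left hxy
  have h₇ := card_link G u
  have h₈ := card_link (cloneGraph G u v) u
  omega

theorem exists_map_card_fiber_eq {ι : Type*} [Fintype ι] (m : ι → ℕ)
    (hm : ∑ i, m i = Fintype.card V) :
    ∃ c : V → ι, ∀ i, (Finset.univ.filter fun x => c x = i).card = m i := by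
  have e : V ≃ Σ i, Fin (m i) := Fintype.equivOfCardEq (by simp [hm])
  refine ⟨fun x => (e x).1, fun i => ?_⟩
  rw [← Fintype.card_subtype, ← Fintype.card_fin (m i)]
  exact Fintype.card_congr ((e.subtypeEquiv fun _ => Iff.rfl).trans (Equiv.sigmaSubtype i))

theorem card_triangles_fiberGraph_le {ι : Type*} [Fintype ι] (c : V → ι) :
    (triangles (fiberGraph c)).card ≤
      ∑ i, ((Finset.univ.filter fun x => c x = i).card).choose 3 := by
  simp only [← Finset.card_powersetCard]
  refine le_trans (Finset.card_le_card fun s hs => ?_) Finset.card_biUnion_le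
  obtain ⟨hcard, hs⟩ := mem_triangles.1 hs
  obtain ⟨x, hx⟩ := Finset.card_pos.1 (by omega : 0 < s.card)
  simp only [Finset.mem_biUnion, Finset.mem_univ, true_and, Finset.mem_powersetCard]
  refine ⟨c x, fun y hy => ?_, hcard⟩
  rcases eq_or_ne y x with rfl | hyx
  · simp
  · simpa using (hs hy hx hyx).2

theorem sum_choose_le_card_triangles {ι : Type*} [Fintype ι] {G : SimpleGraph V} (c : V → ι)
    (hc : ∀ x y, c x = c y → x ≠ y → G.Adj x y) :
    ∑ i, ((Finset.univ.filter fun x => c x = i).card).choose 3 ≤ (triangles G).card := by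
  simp only [← Finset.card_powersetCard]
  rw [← Finset.card_biUnion]
  · refine Finset.card_le_card fun s hs => ?_
    simp only [Finset.mem_biUnion, Finset.mem_univ, true_and, Finset.mem_powersetCard] at hs
    obtain ⟨i, hi, hcard⟩ := hs
    refine mem_triangles.2 ⟨hcard, fun x hx y hy hxy => hc x y ?_ hxy⟩
    have h₁ := hi hx
    have h₂ := hi hy
    simp only [Finset.mem_filter, Finset.mem_univ, true_and] at h₁ h₂
    rw [h₁, h₂]
  · intro i _ j _ hij
    rw [Function.onFun, Finset.disjoint_left]
    intro s hs hs'
    simp only [Finset.mem_powersetCard] at hs hs'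
    obtain ⟨x, hx⟩ := Finset.card_pos.1 (by omega : 0 < s.card)
    have h₁ := hs.1 hx
    have h₂ := hs'.1 hx
    simp only [Finset.mem_filter, Finset.mem_univ, true_and] at h₁ h₂
    exact hij (h₁.symm.trans h₂)

theorem card_triangles_le_of_minimal {G : SimpleGraph V}
    (hmin : ∀ H : SimpleGraph V, IndepBound H 3 → (triangles G).card ≤ (triangles H).card) :
    (triangles G).card ≤ (Fintype.card V / 3).choose 3 + ((Fintype.card V + 1) / 3).choose 3 +
      ((Fintype.card V + 2) / 3).choose 3 := by
  obtain ⟨c, hc⟩ := exists_map_card_fiber_eq (V := V)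
    ![Fintype.card V / 3, (Fintype.card V + 1) / 3, (Fintype.card V + 2) / 3]
    (by simp only [Fin.sum_univ_three, Matrix.cons_val]; omega)
  have h := (hmin _ (indepBound_fiberGraph c)).trans (card_triangles_fiberGraph_le c)
  simpa only [hc, Fin.sum_univ_three, Matrix.cons_val] using h

theorem six_mul_choose_three (s : ℕ) :
    6 * ((s.choose 3 : ℕ) : ℤ) = (s : ℤ) * (s - 1) * (s - 2) := by
  induction s with
  | zero => simp
  | succ k ih =>
    have h₂ : 2 * ((k.choose 2 : ℕ) : ℤ) = (k : ℤ) * (k - 1) := by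
      have := Nat.cast_choose_two ℚ k
      have h : (2 : ℚ) * ((k.choose 2 : ℕ) : ℚ) = (k : ℚ) * (k - 1) := by rw [this]; ring
      exact_mod_cast h
    rw [Nat.choose_succ_succ' k 2]
    push_cast
    linarith

theorem card_triangles_cubic_bound_of_minimal {G : SimpleGraph V}
    (hmin : ∀ H : SimpleGraph V, IndepBound H 3 → (triangles G).card ≤ (triangles H).card) :
    54 * ((triangles G).card : ℤ) ≤ ((Fintype.card V : ℤ) + 2) ^ 3 := by
  have h := card_triangles_le_of_minimal hmin
  have key : ∀ m : ℕ, 3 * m ≤ Fintype.card V + 2 →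
      162 * ((m.choose 3 : ℕ) : ℤ) ≤ ((Fintype.card V : ℤ) + 2) ^ 3 := by
    intro m hm
    have h₁ := six_mul_choose_three m
    have h₂ : (m : ℤ) * (m - 1) * (m - 2) ≤ (m : ℤ) ^ 3 := by
      rcases Nat.eq_zero_or_pos m with rfl | hm
      · simp
      · have : (1 : ℤ) ≤ m := by exact_mod_cast hm
        nlinarith
    have h₃ : (3 * (m : ℤ)) ^ 3 ≤ ((Fintype.card V : ℤ) + 2) ^ 3 := by
      gcongr
      exact_mod_cast hm
    nlinarith
  have h₁ := key (Fintype.card V / 3) (by omega)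
  have h₂ := key ((Fintype.card V + 1) / 3) (by omega)
  have h₃ := key ((Fintype.card V + 2) / 3) (by omega)
  have h' : ((triangles G).card : ℤ) ≤ ((Fintype.card V / 3).choose 3 : ℕ) +
      (((Fintype.card V + 1) / 3).choose 3 : ℕ) + (((Fintype.card V + 2) / 3).choose 3 : ℕ) := by
    exact_mod_cast h
  linarith

theorem choose_three_convexity (s q : ℕ) :
    6 * ((s.choose 3 : ℕ) : ℤ) = 6 * ((q.choose 3 : ℕ) : ℤ) + 3 * (s - q) * (q * (q - 1)) +
      (s - q) * (s - q - 1) * (s + 2 * q - 2) := by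
  rw [six_mul_choose_three, six_mul_choose_three]
  ring

theorem balanced_of_sum_choose_three_le {n a b c : ℕ} (hn : 6 ≤ n) (hsum : a + b + c = n)
    (hab : a ≤ b) (hbc : b ≤ c)
    (h : a.choose 3 + b.choose 3 + c.choose 3 ≤
      (n / 3).choose 3 + ((n + 1) / 3).choose 3 + ((n + 2) / 3).choose 3) :
    a = n / 3 ∧ b = (n + 1) / 3 ∧ c = (n + 2) / 3 := by
  have hq : (2 : ℤ) ≤ (n / 3 : ℕ) := by
    have : 2 ≤ n / 3 := by omega
    exact_mod_cast this
  set q := n / 3 with hqdef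
  have hzero : ∀ s : ℕ, s = q ∨ s = q + 1 →
      ((s : ℤ) - q) * (s - q - 1) * (s + 2 * q - 2) = 0 := by
    rintro s (rfl | rfl)
    · simp
    · push_cast
      ring
  have hnonneg : ∀ s : ℕ, 0 ≤ ((s : ℤ) - q) * (s - q - 1) * (s + 2 * q - 2) := by
    intro s
    have h₂ : (0 : ℤ) ≤ s + 2 * q - 2 := by omega
    refine mul_nonneg ?_ h₂
    rcases le_or_gt s q with hs | hs
    · exact mul_nonneg_of_nonpos_of_nonpos (by omega) (by omega)
    · exact mul_nonneg (by omega) (by omega)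
  have hmem : ∀ s : ℕ, ((s : ℤ) - q) * (s - q - 1) * (s + 2 * q - 2) ≤ 0 → s = q ∨ s = q + 1 := by
    intro s hs
    have := le_antisymm hs (hnonneg s)
    rcases mul_eq_zero.1 this with h | h
    · rcases mul_eq_zero.1 h with h | h <;> omega
    · omega
  have h' : ((a.choose 3 : ℕ) : ℤ) + (b.choose 3 : ℕ) + (c.choose 3 : ℕ) ≤
      (q.choose 3 : ℕ) + (((n + 1) / 3).choose 3 : ℕ) + (((n + 2) / 3).choose 3 : ℕ) := by
    exact_mod_cast h
  have ea := choose_three_convexity a q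
  have eb := choose_three_convexity b q
  have ec := choose_three_convexity c q
  have e₁ := choose_three_convexity ((n + 1) / 3) q
  have e₂ := choose_three_convexity ((n + 2) / 3) q
  rw [hzero _ (by omega)] at e₁ e₂
  have hs : (3 * ((a : ℤ) - q) * (q * (q - 1)) + 3 * ((b : ℤ) - q) * (q * (q - 1)) +
      3 * ((c : ℤ) - q) * (q * (q - 1))) =
      3 * ((((n + 1) / 3 : ℕ) : ℤ) - q) * (q * (q - 1)) +
      3 * ((((n + 2) / 3 : ℕ) : ℤ) - q) * (q * (q - 1)) := by
    have : (a : ℤ) + b + c = q + ((n + 1) / 3 : ℕ) + ((n + 2) / 3 : ℕ) := by omega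
    linear_combination (3 * (q : ℤ) * (q - 1)) * this
  have ha := hnonneg a
  have hb := hnonneg b
  have hc := hnonneg c
  have ma := hmem a (by linarith)
  have mb := hmem b (by linarith)
  have mc := hmem c (by linarith)
  omega

end Comparison

section Structure

open scoped Classical

variable {V : Type*} {G : SimpleGraph V}

/-- The number of vertices of `S` equal or adjacent to `u`. -/
noncomputable def degIn (G : SimpleGraph V) (S : Finset V) (u : V) : ℕ :=
  (S.filter fun x => closedAdj G u x).card

theorem exists_mem_forall_not_closedAdj {S : Finset V} {k : ℕ} (t : Fin k → V)
    (h : ∑ i, (degIn G S (t i) : ℝ) < S.card) :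
    ∃ y ∈ S, ∀ i, ¬ closedAdj G (t i) y = true := by
  by_contra! hcon
  have hsub : S ⊆ Finset.univ.biUnion fun i => S.filter fun x => closedAdj G (t i) x := by
    intro y hy
    obtain ⟨i, hi⟩ := hcon y hy
    simp only [Finset.mem_biUnion, Finset.mem_univ, true_and, Finset.mem_filter]
    exact ⟨i, hy, hi⟩
  have hle := (Finset.card_le_card hsub).trans Finset.card_biUnion_le
  have : (S.card : ℝ) ≤ ∑ i, (degIn G S (t i) : ℝ) := by exact_mod_cast hle
  linarith

theorem exists_clique_partition_of_approx (hG : IndepBound G 3) {n : ℝ} (hn : 0 < n)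
    (S : Fin 3 → Finset V) (hclique : ∀ i, ∀ x ∈ S i, ∀ y ∈ S i, closedAdj G x y = true)
    (hcard : ∀ i, 0.33333 * n ≤ (S i).card)
    (hsq : ∀ u, ∑ i, (degIn G (S i) u : ℝ) ^ 2 ≤ 0.1111112 * n ^ 2) :
    ∃ c : V → Fin 3, ∀ x y, c x = c y → closedAdj G x y = true := by
  have hpair : ∀ (u : V) (i j : Fin 3), i ≠ j →
      (degIn G (S i) u : ℝ) ^ 2 + (degIn G (S j) u : ℝ) ^ 2 ≤ 0.1111112 * n ^ 2 := by
    intro u i j hij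
    refine le_trans ?_ (hsq u)
    rw [← Finset.sum_pair (f := fun i => (degIn G (S i) u : ℝ) ^ 2) hij]
    exact Finset.sum_le_univ_sum_of_nonneg fun _ => sq_nonneg _
  have hfar : ∀ (i j : Fin 3) (y : V), i ≠ j → y ∈ S i → (degIn G (S j) y : ℝ) ≤ 0.002 * n := by
    intro i j y hij hy
    have h₁ := hpair y i j hij
    have h₂ : degIn G (S i) y = (S i).card := by
      rw [degIn, Finset.filter_true_of_mem fun x hx => hclique i y hy x hx]
    rw [h₂] at h₁
    have h₃ := hcard i
    by_contra! h
    nlinarith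
  have hclass : ∀ u, ∃ i, ((S i).card : ℝ) - degIn G (S i) u ≤ 0.004 * n := by
    intro u
    by_contra! h
    obtain ⟨y₀, hy₀, h₀⟩ := exists_mem_forall_not_closedAdj (G := G) (S := S 0) ![u] (by
      simpa using (sub_pos.1 (lt_trans (by positivity) (h 0)) : (degIn G (S 0) u : ℝ) < _))
    obtain ⟨y₁, hy₁, h₁⟩ := exists_mem_forall_not_closedAdj (G := G) (S := S 1) ![u, y₀] (by
      have := hfar 0 1 y₀ (by decide) hy₀
      have := h 1
      simp only [Fin.sum_univ_two, Matrix.cons_val]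
      linarith)
    obtain ⟨y₂, hy₂, h₂⟩ := exists_mem_forall_not_closedAdj (G := G) (S := S 2) ![u, y₀, y₁] (by
      have := hfar 0 2 y₀ (by decide) hy₀
      have := hfar 1 2 y₁ (by decide) hy₁
      have := h 2
      simp only [Fin.sum_univ_three, Matrix.cons_val]
      linarith)
    simp only [Fin.forall_fin_succ, Matrix.cons_val_zero, Matrix.cons_val_succ, IsEmpty.forall_iff,
      and_true] at h₀ h₁ h₂
    have := closedAdj_of_indepBound hG u y₀ y₁ y₂
    tauto
  choose c hc using hclass
  have hother : ∀ (u : V) (j : Fin 3), c u ≠ j → (degIn G (S j) u : ℝ) ≤ 0.06 * n := by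
    intro u j hj
    have h₁ := hpair u (c u) j hj
    have h₂ := hcard (c u)
    have h₃ := hc u
    have h₄ : 0.32933 * n ≤ degIn G (S (c u)) u := by linarith
    by_contra! h
    nlinarith
  refine ⟨c, fun u v huv => ?_⟩
  by_contra hadj
  obtain ⟨j, k, hj, hk, hjk⟩ : ∃ j k : Fin 3, c u ≠ j ∧ c u ≠ k ∧ j ≠ k := by
    generalize c u = i
    revert i
    decide
  obtain ⟨y, hy, h₁⟩ := exists_mem_forall_not_closedAdj (G := G) (S := S j) ![u, v] (by
    have := hother u j hj
    have := hother v j (huv ▸ hj)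
    have := hcard j
    simp only [Fin.sum_univ_two, Matrix.cons_val]
    linarith)
  obtain ⟨z, hz, h₂⟩ := exists_mem_forall_not_closedAdj (G := G) (S := S k) ![u, v, y] (by
    have := hother u k hk
    have := hother v k (huv ▸ hk)
    have := hfar j k y hjk hy
    have := hcard k
    simp only [Fin.sum_univ_three, Matrix.cons_val]
    linarith)
  simp only [Fin.forall_fin_succ, Matrix.cons_val_zero, Matrix.cons_val_succ, IsEmpty.forall_iff,
    and_true] at h₁ h₂
  have := closedAdj_of_indepBound hG u v y z
  tauto

variable [Fintype V]

theorem sum_degIn_sq_le (S : Fin 3 → Finset V)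
    (hclique : ∀ i, ∀ x ∈ S i, ∀ y ∈ S i, closedAdj G x y = true)
    (hdisj : ∀ i j, i ≠ j → Disjoint (S i) (S j)) (u : V) :
    ∑ i, degIn G (S i) u ^ 2 ≤ (closedLink G u).card := by
  have hcard : ∀ i, degIn G (S i) u ^ 2 = (((S i).filter fun x => closedAdj G u x) ×ˢ
      ((S i).filter fun x => closedAdj G u x)).card := by
    intro i
    rw [Finset.card_product, degIn, sq]
  simp only [hcard]
  rw [← Finset.card_biUnion]
  · refine Finset.card_le_card fun p hp => ?_
    simp only [Finset.mem_biUnion, Finset.mem_univ, true_and, Finset.mem_product,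
      Finset.mem_filter] at hp
    obtain ⟨i, ⟨h₁, h₂⟩, h₃, h₄⟩ := hp
    simp only [closedLink, Finset.mem_filter, Finset.mem_univ, true_and]
    exact ⟨h₂, h₄, hclique i _ h₁ _ h₃⟩
  · intro i _ j _ hij
    rw [Function.onFun, Finset.disjoint_left]
    intro p hp hp'
    simp only [Finset.mem_product, Finset.mem_filter] at hp hp'
    exact Finset.disjoint_left.1 (hdisj i j hij) hp.1.1 hp'.1.1

theorem card_highDegree_le [Nonempty V] (hG : IndepBound G 3)
    (ht : 54 * ((triangles G).card : ℤ) ≤ ((Fintype.card V : ℤ) + 2) ^ 3) :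
    ((Finset.univ.filter fun x =>
      0.333335 * (Fintype.card V : ℝ) < (closedNbhd G x).card).card : ℝ) ≤ 10 ^ 15 := by
  set B := Finset.univ.filter fun x => 0.333335 * (Fintype.card V : ℝ) < (closedNbhd G x).card
    with hB
  set n : ℝ := (Fintype.card V : ℝ) with hn
  have hn₁ : 1 ≤ n := by
    rw [hn]
    exact_mod_cast Fintype.card_pos (α := V)
  have h₁ : 432 * ∑ x, (6 * ((closedNbhd G x).card : ℝ) - 2 * n) ^ 2 ≤
      328320 * (54 * (triangles G).card + 27 * n ^ 2 - n ^ 3) := by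
    have := sum_closedNbhd_deviation_le hG
    rw [hn]
    exact_mod_cast this
  have h₂ : 54 * ((triangles G).card : ℝ) ≤ (n + 2) ^ 3 := by
    rw [hn]
    exact_mod_cast ht
  have h₃ : (B.card : ℝ) * (1 / 10 ^ 10 * n ^ 2) ≤
      ∑ x, (6 * ((closedNbhd G x).card : ℝ) - 2 * n) ^ 2 := by
    rw [← nsmul_eq_mul]
    refine (Finset.card_nsmul_le_sum B _ _ fun x hx => ?_).trans
      (Finset.sum_le_univ_sum_of_nonneg fun _ => sq_nonneg _)
    have hx' := (Finset.mem_filter.1 hx).2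
    have : 1 / 10 ^ 5 * n ≤ 6 * ((closedNbhd G x).card : ℝ) - 2 * n := by linarith
    calc 1 / 10 ^ 10 * n ^ 2 = (1 / 10 ^ 5 * n) ^ 2 := by ring
      _ ≤ _ := by gcongr
  have h₄ : (B.card : ℝ) * n ^ 2 ≤ 10 ^ 15 * n ^ 2 := by nlinarith
  exact le_of_mul_le_mul_right h₄ (by positivity)

theorem card_closedLink_le_of_minimal [Nonempty V] (hG : IndepBound G 3)
    (hmin : ∀ H : SimpleGraph V, IndepBound H 3 → (triangles G).card ≤ (triangles H).card)
    (u : V) :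
    9 * ((closedLink G u).card : ℝ) ≤ (Fintype.card V : ℝ) ^ 2 + 80 * Fintype.card V := by
  set n : ℝ := (Fintype.card V : ℝ) with hn
  have hn₁ : 1 ≤ n := by
    rw [hn]
    exact_mod_cast Fintype.card_pos (α := V)
  have h₁ : ∀ v, ((closedLink G u).card : ℝ) ≤ (link G v).card + 6 * n := by
    intro v
    have h₁ := card_closedLink_le G u
    have h₂ := card_link_le_of_minimal hG hmin u v
    have : (closedLink G u).card ≤ (link G v).card + 6 * Fintype.card V := by omega
    rw [hn]
    exact_mod_cast this
  have h₂ : n * ((closedLink G u).card : ℝ) ≤ 6 * (triangles G).card + 6 * n * n := by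
    have h := Finset.sum_le_sum fun v (_ : v ∈ Finset.univ) => h₁ v
    have hs : ∑ v, ((link G v).card : ℝ) = 6 * (triangles G).card := by
      exact_mod_cast sum_card_link G
    rw [Finset.sum_add_distrib, hs, Finset.sum_const, Finset.sum_const, Finset.card_univ,
      nsmul_eq_mul, nsmul_eq_mul] at h
    linarith
  have h₃ : 54 * ((triangles G).card : ℝ) ≤ (n + 2) ^ 3 := by
    rw [hn]
    exact_mod_cast card_triangles_cubic_bound_of_minimal hmin
  refine le_of_mul_le_mul_left ?_ (by linarith : 0 < n)
  nlinarith

theorem exists_clique_partition_of_minimal (hG : IndepBound G 3)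
    (hmin : ∀ H : SimpleGraph V, IndepBound H 3 → (triangles G).card ≤ (triangles H).card)
    (hV : 10 ^ 20 ≤ Fintype.card V) :
    ∃ c : V → Fin 3, ∀ x y, c x = c y → closedAdj G x y = true := by
  have : Nonempty V := Fintype.card_pos_iff.1 (lt_of_lt_of_le (by norm_num) hV)
  have hbad := card_highDegree_le hG (card_triangles_cubic_bound_of_minimal hmin)
  have hlink := card_closedLink_le_of_minimal hG hmin
  have hn : (10 : ℝ) ^ 20 ≤ (Fintype.card V : ℝ) := by exact_mod_cast hV
  set B := Finset.univ.filter fun x => 0.333335 * (Fintype.card V : ℝ) < (closedNbhd G x).card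
    with hB
  set n : ℝ := (Fintype.card V : ℝ) with hndef
  have hgood : ∀ x, x ∉ B → ((closedNbhd G x).card : ℝ) ≤ 0.333335 * n := by
    intro x hx
    simpa [hB] using hx
  have hpick : ∀ T : Finset V, (T.card : ℝ) ≤ 0.66667 * n → ∃ x, x ∉ B ∧ x ∉ T := by
    intro T hT
    by_contra! h
    have hsub : (Finset.univ : Finset V) ⊆ B ∪ T := fun x _ => by
      by_cases hx : x ∈ B
      · exact Finset.mem_union_left _ hx
      · exact Finset.mem_union_right _ (h x hx)
    have h₁ := (Finset.card_le_card hsub).trans (Finset.card_union_le B T)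
    rw [Finset.card_univ] at h₁
    have h₂ : n ≤ (B.card : ℝ) + T.card := by
      rw [hndef]
      exact_mod_cast h₁
    norm_num at hn
    linarith
  have hunion : ∀ x y, x ∉ B → y ∉ B →
      ((closedNbhd G x ∪ closedNbhd G y).card : ℝ) ≤ 0.66667 * n := by
    intro x y hx hy
    have h : ((closedNbhd G x ∪ closedNbhd G y).card : ℝ) ≤
        (closedNbhd G x).card + (closedNbhd G y).card := by
      exact_mod_cast Finset.card_union_le _ _
    have := hgood x hx
    have := hgood y hy
    linarith
  obtain ⟨v₀, hv₀, -⟩ := hpick ∅ (by simp; positivity)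
  obtain ⟨v₁, hv₁, h₁⟩ := hpick (closedNbhd G v₀) (by have := hgood v₀ hv₀; linarith)
  obtain ⟨v₂, hv₂, h₂⟩ := hpick (closedNbhd G v₀ ∪ closedNbhd G v₁) (hunion _ _ hv₀ hv₁)
  have mem_closedNbhd : ∀ x y, y ∈ closedNbhd G x ↔ closedAdj G x y = true := by
    simp [closedNbhd]
  simp only [Finset.mem_union, mem_closedNbhd, not_or] at h₁ h₂
  obtain ⟨h₂, h₃⟩ := h₂
  have hind := closedAdj_of_indepBound hG
  have hcompl : ∀ x y, x ∉ B → y ∉ B →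
      0.33333 * n ≤ ((closedNbhd G x ∪ closedNbhd G y)ᶜ.card : ℝ) := by
    intro x y hx hy
    rw [Finset.card_compl, Nat.cast_sub (Finset.card_le_univ _)]
    linarith [hunion x y hx hy]
  have hmem : ∀ x y z, z ∈ (closedNbhd G x ∪ closedNbhd G y)ᶜ ↔
      ¬ closedAdj G x z = true ∧ ¬ closedAdj G y z = true := by
    simp [mem_closedNbhd]
  let S : Fin 3 → Finset V := ![(closedNbhd G v₁ ∪ closedNbhd G v₂)ᶜ,
    (closedNbhd G v₀ ∪ closedNbhd G v₂)ᶜ, (closedNbhd G v₀ ∪ closedNbhd G v₁)ᶜ]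
  have hclique : ∀ i, ∀ x ∈ S i, ∀ y ∈ S i, closedAdj G x y = true := by
    intro i x hx y hy
    fin_cases i <;> simp only [S, Fin.zero_eta, Fin.mk_one, Fin.reduceFinMk, Matrix.cons_val,
      hmem] at hx hy
    · have := hind v₁ v₂ x y
      tauto
    · have := hind v₀ v₂ x y
      tauto
    · have := hind v₀ v₁ x y
      tauto
  have hdisj : ∀ i j, i ≠ j → Disjoint (S i) (S j) := by
    intro i j hij
    rw [Finset.disjoint_left]
    intro x hx hy
    have := hind v₀ v₁ v₂ x
    fin_cases i <;> fin_cases j <;> simp only [S, Fin.zero_eta, Fin.mk_one, Fin.reduceFinMk,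
      Matrix.cons_val, hmem] at hx hy <;> tauto
  refine exists_clique_partition_of_approx hG (n := n) (by linarith) S hclique ?_ fun u => ?_
  · intro i
    fin_cases i
    · exact hcompl _ _ hv₁ hv₂
    · exact hcompl _ _ hv₀ hv₂
    · exact hcompl _ _ hv₀ hv₁
  · have h : ∑ i, (degIn G (S i) u : ℝ) ^ 2 ≤ (closedLink G u).card := by
      exact_mod_cast sum_degIn_sq_le S hclique hdisj u
    have := hlink u
    norm_num at hn
    nlinarith

end Structure

end TriangleMinimization

open TriangleMinimization

/-- For large n, any extremal graph for the (3,4)-problem is spanned by three nearly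
equal cliques: the vertex set can be partitioned into cliques of sizes
⌊n/3⌋, ⌊(n+1)/3⌋, ⌊(n+2)/3⌋. -/
theorem erdos_34_extremal_structure :
    ∃ n₀ : ℕ, ∀ n : ℕ, n₀ ≤ n →
      ∀ G : SimpleGraph (Fin n), IndepBound G 3 → cliqueCount G 3 = minCliques n 3 4 →
        ∃ C₁ C₂ C₃ : Finset (Fin n),
          Disjoint C₁ C₂ ∧ Disjoint C₁ C₃ ∧ Disjoint C₂ C₃ ∧
          C₁ ∪ C₂ ∪ C₃ = Finset.univ ∧
          C₁.card = n / 3 ∧ C₂.card = (n + 1) / 3 ∧ C₃.card = (n + 2) / 3 ∧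
          G.IsClique (C₁ : Set (Fin n)) ∧ G.IsClique (C₂ : Set (Fin n)) ∧
          G.IsClique (C₃ : Set (Fin n)) := by
  classical
  refine ⟨10 ^ 20, fun n hn G hG hcount => ?_⟩
  have hmin : ∀ H : SimpleGraph (Fin n), IndepBound H 3 →
      (triangles G).card ≤ (triangles H).card := by
    intro H hH
    rw [← cliqueCount_three, ← cliqueCount_three, hcount]
    exact Nat.sInf_le ⟨H, hH, rfl⟩
  obtain ⟨c, hc⟩ := exists_clique_partition_of_minimal hG hmin (by simpa using hn)
  let m : Fin 3 → ℕ := fun i => (Finset.univ.filter fun x => c x = i).card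
  have hmono : Monotone (m ∘ Tuple.sort m) := Tuple.monotone_sort m
  set e := Tuple.sort m
  have hsum : ∑ i, m (e i) = n := by
    rw [Equiv.sum_comp e m, ← Finset.card_eq_sum_card_fiberwise (fun _ _ => Finset.mem_univ _)]
    simp
  have hcl : ∀ x y, c x = c y → x ≠ y → G.Adj x y := fun x y hxy hne =>
    (closedAdj_iff.1 (hc x y hxy)).resolve_left hne
  have hchoose : ∑ i, (m (e i)).choose 3 ≤
      (n / 3).choose 3 + ((n + 1) / 3).choose 3 + ((n + 2) / 3).choose 3 := by
    rw [Equiv.sum_comp e fun i => (m i).choose 3]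
    have h := (sum_choose_le_card_triangles c hcl).trans (card_triangles_le_of_minimal hmin)
    rw [Fintype.card_fin] at h
    refine le_trans (le_of_eq (Finset.sum_congr rfl fun i _ => ?_)) h
    congr!
  rw [Fin.sum_univ_three] at hsum hchoose
  obtain ⟨h₀, h₁, h₂⟩ := balanced_of_sum_choose_three_le (by omega) hsum
    (hmono (by decide : (0 : Fin 3) ≤ 1)) (hmono (by decide : (1 : Fin 3) ≤ 2)) hchoose
  have hdisj : ∀ i j : Fin 3, i ≠ j → Disjoint (Finset.univ.filter fun x => c x = e i)
      (Finset.univ.filter fun x => c x = e j) := by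
    intro i j hij
    rw [Finset.disjoint_left]
    intro x hx hy
    simp only [Finset.mem_filter, Finset.mem_univ, true_and] at hx hy
    exact hij (e.injective (hx.symm.trans hy))
  have hclique : ∀ i : Fin 3, G.IsClique
      ((Finset.univ.filter fun x => c x = e i : Finset (Fin n)) : Set (Fin n)) := by
    intro i x hx y hy hxy
    simp only [Finset.coe_filter, Finset.mem_univ, true_and, Set.mem_ofPred_eq] at hx hy
    exact hcl x y (hx.trans hy.symm) hxy
  refine ⟨_, _, _, hdisj 0 1 (by decide), hdisj 0 2 (by decide), hdisj 1 2 (by decide), ?_, h₀, h₁,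
    h₂, hclique 0, hclique 1, hclique 2⟩
  ext x
  obtain ⟨i, hi⟩ := e.surjective (c x)
  simp only [Finset.mem_union, Finset.mem_filter, Finset.mem_univ, true_and, ← hi,
    e.injective.eq_iff, iff_true]
  fin_cases i <;> simp
end

section
/- For all integers k ≥ 4 and l ≥ 3 there exists n₀ such that for every n ≥ n₀ there is a simple graph G on n vertices with independence number at most l−1 satisfying t_k(G) < Σ_{i=0}^{l−2} C(⌊(n+i)/(l−1)⌋, k); that is, the disjoint union of l−1 cliques of nearly-equal sizes is not optimal for the (k,l)-problem. -/
open Finset Filter Topology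

/-- The blow-up of `H` along `f`, in which every fibre of `f` becomes a clique. -/
def cliqueBlowup {V C : Type*} (H : SimpleGraph C) (f : V → C) : SimpleGraph V where
  Adj u v := u ≠ v ∧ (f u = f v ∨ H.Adj (f u) (f v))
  symm := ⟨fun _ _ h => ⟨h.1.symm, h.2.imp Eq.symm fun h => h.symm⟩⟩
  loopless := ⟨fun _ h => h.1 rfl⟩

theorem IndepBound.blowup {V C : Type*} {H : SimpleGraph C} {m : ℕ}
    (hH : IndepBound H m) (f : V → C) : IndepBound (cliqueBlowup H f) m := by
  classical
  intro s hs
  have hinj : Set.InjOn f s := by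
    intro u hu v hv huv
    by_contra hne
    exact hs u hu v hv hne ⟨hne, Or.inl huv⟩
  rw [← card_image_of_injOn hinj]
  refine hH _ ?_
  simp only [mem_image]
  rintro _ ⟨u, hu, rfl⟩ _ ⟨v, hv, rfl⟩ hne hadj
  have huv : u ≠ v := fun h => hne (congrArg f h)
  exact hs u hu v hv huv ⟨huv, Or.inr hadj⟩

theorem IndepBound.sum {A B : Type*} {G : SimpleGraph A} {H : SimpleGraph B} {a b : ℕ}
    (hG : IndepBound G a) (hH : IndepBound H b) : IndepBound (G ⊕g H) (a + b) := by
  intro s hs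
  rw [← card_toLeft_add_card_toRight (u := s)]
  refine Nat.add_le_add (hG _ fun u hu v hv huv => ?_) (hH _ fun u hu v hv huv => ?_)
  · simpa using hs _ (mem_toLeft.1 hu) _ (mem_toLeft.1 hv) (by simpa using huv)
  · simpa using hs _ (mem_toRight.1 hu) _ (mem_toRight.1 hv) (by simpa using huv)

theorem indepBound_card {V : Type*} [Fintype V] (G : SimpleGraph V) :
    IndepBound G (Fintype.card V) :=
  fun s _ => s.card_le_univ

theorem indepBound_cycleGraph_five : IndepBound (SimpleGraph.cycleGraph 5) 2 := by
  unfold IndepBound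
  decide

theorem cycleGraph_five_clique_subset (t : Finset (Fin 5)) (ht : t.Nonempty)
    (hadj : ∀ a ∈ t, ∀ b ∈ t, a = b ∨ (SimpleGraph.cycleGraph 5).Adj a b) :
    ∃ c, c + 1 ∈ t ∧ ∀ a ∈ t, a = c ∨ a = c + 1 := by
  revert t
  decide

theorem cliqueCount_le_card {V : Type*} [Fintype V] {G : SimpleGraph V} {k : ℕ}
    (T : Finset (Finset V)) (hT : ∀ s : Finset V, #s = k → G.IsClique (s : Set V) → s ∈ T) :
    cliqueCount G k ≤ #T := by
  rw [← Nat.card_eq_finsetCard T]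
  exact Nat.card_le_card_of_injective
    (fun s => (⟨s.1, hT s.1 s.2.1 s.2.2⟩ : T))
    fun _ _ h => Subtype.ext (congrArg (fun x : T => x.1) h)

theorem exists_fin_fiber_card {C : Type*} [Fintype C] [DecidableEq C] (s : C → ℕ) {n : ℕ}
    (hn : ∑ c, s c = n) : ∃ f : Fin n → C, ∀ c, #{v | f v = c} = s c := by
  have hcard : Fintype.card (Fin n) = Fintype.card (Σ c, Fin (s c)) := by simp [hn]
  let e := Fintype.equivOfCardEq hcard
  refine ⟨fun v => (e v).1, fun c => ?_⟩
  rw [← Fintype.card_subtype, Fintype.card_congr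
    ((e.subtypeEquiv (q := fun x => x.1 = c) fun _ => Iff.rfl).trans (Equiv.sigmaSubtype c)),
    Fintype.card_fin]

/-- A pentagon together with `r` isolated vertices. -/
abbrev pentagonWithIsolated (r : ℕ) : SimpleGraph (Fin 5 ⊕ Fin r) :=
  SimpleGraph.cycleGraph 5 ⊕g ⊥

theorem cliqueCount_pentagon_blowup_le {V : Type*} [Fintype V] [DecidableEq V] {r k : ℕ}
    (hk : k ≠ 0) (f : V → Fin 5 ⊕ Fin r) (s : Fin 5 ⊕ Fin r → ℕ)
    (hf : ∀ c, #{v | f v = c} = s c) :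
    cliqueCount (cliqueBlowup (pentagonWithIsolated r) f) k ≤
      ∑ c : Fin 5, ((s (.inl c) + s (.inl (c + 1))).choose k - (s (.inl c)).choose k) +
        ∑ j : Fin r, (s (.inr j)).choose k := by
  let F : Fin 5 ⊕ Fin r → Finset V := fun c => {v | f v = c}
  refine (cliqueCount_le_card
    ((univ.biUnion fun c : Fin 5 =>
        powersetCard k (F (.inl c) ∪ F (.inl (c + 1))) \ powersetCard k (F (.inl c))) ∪
      univ.biUnion fun j : Fin r => powersetCard k (F (.inr j))) ?_).trans ?_
  · intro t htk ht
    have hadj : ∀ u ∈ t, ∀ v ∈ t, f u = f v ∨ (pentagonWithIsolated r).Adj (f u) (f v) := by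
      intro u hu v hv
      by_cases huv : u = v
      · exact Or.inl (congrArg f huv)
      · exact (ht hu hv huv).2
    have hne : t.Nonempty := card_ne_zero.1 (htk ▸ hk)
    simp only [mem_union, mem_biUnion, mem_univ, true_and, Finset.mem_sdiff, mem_powersetCard, htk,
      and_true]
    by_cases hr : ∃ v ∈ t, ∃ j, f v = .inr j
    · obtain ⟨v, hv, j, hj⟩ := hr
      refine Or.inr ⟨j, fun u hu => ?_⟩
      have := hadj u hu v hv
      rw [hj] at this
      rcases hfu : f u with c | i <;> simp_all [F]
    · have hl : ∀ v ∈ t, ∃ c, f v = .inl c := by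
        intro v hv
        rcases hfv : f v with c | j
        · exact ⟨c, rfl⟩
        · exact (hr ⟨v, hv, j, hfv⟩).elim
      obtain ⟨c, hc, hsub⟩ := cycleGraph_five_clique_subset (t.image f).toLeft (by
        obtain ⟨v, hv⟩ := hne
        obtain ⟨c, hc⟩ := hl v hv
        exact ⟨c, mem_toLeft.2 (mem_image.2 ⟨v, hv, hc⟩)⟩) (by
        intro a ha b hb
        obtain ⟨u, hu, hua⟩ := mem_image.1 (mem_toLeft.1 ha)
        obtain ⟨v, hv, hvb⟩ := mem_image.1 (mem_toLeft.1 hb)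
        simpa [hua, hvb] using hadj u hu v hv)
      refine Or.inl ⟨c, fun v hv => ?_, fun h => ?_⟩
      · obtain ⟨a, ha⟩ := hl v hv
        have := hsub a (mem_toLeft.2 (mem_image.2 ⟨v, hv, ha⟩))
        simpa [F, ha] using this
      · obtain ⟨v, hv, hvc⟩ := mem_image.1 (mem_toLeft.1 hc)
        simpa [F, hvc] using h hv
  · refine (card_union_le _ _).trans (Nat.add_le_add ?_ ?_)
    · refine card_biUnion_le.trans (sum_le_sum fun c _ => ?_)
      have hdisj : Disjoint (F (.inl c)) (F (.inl (c + 1))) := by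
        refine disjoint_filter.2 fun v _ h h' => ?_
        simp [h] at h'
      rw [card_sdiff_of_subset (powersetCard_mono subset_union_left), card_powersetCard,
        card_powersetCard, card_union_of_disjoint hdisj, hf, hf]
    · refine card_biUnion_le.trans (sum_le_sum fun j _ => ?_)
      rw [card_powersetCard, hf]

theorem sum_range_add_div (n q : ℕ) (hq : 0 < q) : ∑ i ∈ range q, (n + i) / q = n := by
  induction n with
  | zero =>
    refine sum_eq_zero fun i hi => ?_
    simpa using Nat.div_eq_of_lt (mem_range.1 hi)
  | succ n ih =>
    have h := sum_range_succ (fun i => (n + i) / q) q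
    rw [sum_range_succ', ih, Nat.add_div_right _ hq] at h
    simp only [add_zero, add_assoc] at h ⊢
    simp only [add_comm 1]
    omega

theorem tendsto_choose_linear_div_pow (k a b : ℕ) (ha : 0 < a) :
    Tendsto (fun q : ℕ => ((a * q + b).choose k : ℝ) / (q : ℝ) ^ k) atTop
      (𝓝 ((a : ℝ) ^ k / k.factorial)) := by
  have hu : Tendsto (fun q : ℕ => a * q + b) atTop atTop :=
    tendsto_atTop_mono (fun q => (Nat.le_mul_of_pos_left q ha).trans (Nat.le_add_right _ b))
      tendsto_id
  have hlin : Tendsto (fun q : ℕ => ((a * q + b : ℕ) : ℝ) / q) atTop (𝓝 a) := by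
    have := (tendsto_const_div_atTop_nhds_zero_nat (b : ℝ)).const_add (a : ℝ)
    rw [add_zero] at this
    refine this.congr' ?_
    filter_upwards [eventually_gt_atTop 0] with q hq
    have : (q : ℝ) ≠ 0 := by positivity
    push_cast
    field_simp
  have hequiv := (isEquivalent_choose k).comp_tendsto hu
  have hdiv := hequiv.div (Asymptotics.IsEquivalent.refl (u := fun q : ℕ => (q : ℝ) ^ k))
  refine hdiv.symm.tendsto_nhds ?_
  refine ((hlin.pow k).div_const (k.factorial : ℝ)).congr fun q => ?_
  simp only [Function.comp, Pi.div_apply, div_pow]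
  ring

theorem five_mul_two_pow_lt (k : ℕ) (hk : 4 ≤ k) :
    5 * (4 : ℝ) ^ k < 5 * 2 ^ k + 2 * 5 ^ k := by
  induction k, hk using Nat.le_induction with
  | base => norm_num
  | succ k hk ih =>
    have h1 : (5 : ℝ) * 2 ^ k < 5 ^ k := by
      clear ih
      induction k, hk using Nat.le_induction with
      | base => norm_num
      | succ k hk ih => rw [pow_succ, pow_succ]; nlinarith [pow_pos (two_pos (α := ℝ)) k]
    rw [pow_succ, pow_succ, pow_succ]
    linarith

theorem eventually_choose_lt (k : ℕ) (hk : 4 ≤ k) :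
    ∀ᶠ q : ℕ in atTop,
      5 * (4 * q + 4).choose k < 5 * (2 * q).choose k + 2 * (5 * q).choose k := by
  have h4 := (tendsto_choose_linear_div_pow k 4 4 (by norm_num)).const_mul 5
  have h2 := (tendsto_choose_linear_div_pow k 2 0 (by norm_num)).const_mul 5
  have h5 := (tendsto_choose_linear_div_pow k 5 0 (by norm_num)).const_mul 2
  have hlt := h4.eventually_lt (h2.add h5) (by
    have hfac : (0 : ℝ) < k.factorial := by positivity
    have := div_lt_div_of_pos_right (five_mul_two_pow_lt k hk) hfac
    push_cast
    simpa only [add_div, mul_div_assoc] using this)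
  filter_upwards [hlt, eventually_gt_atTop 0] with q hq hq0
  have hpos : (0 : ℝ) < (q : ℝ) ^ k := by positivity
  simp only [← mul_div_assoc, ← add_div] at hq
  exact_mod_cast (div_lt_div_iff_of_pos_right hpos).1 hq

/-- For k ≥ 4 and l ≥ 3, the disjoint union of l−1 nearly-equal cliques (with
Σ_{i<l−1} C(⌊(n+i)/(l−1)⌋,k) k-cliques) is not optimal for the (k,l)-problem: for
large n there is a graph on n vertices with independence number at most l−1 and
strictly fewer k-cliques. -/
theorem turan_complement_not_optimal :
    ∀ k l : ℕ, 4 ≤ k → 3 ≤ l →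
      ∃ n₀ : ℕ, ∀ n : ℕ, n₀ ≤ n →
        ∃ G : SimpleGraph (Fin n), IndepBound G (l - 1) ∧
          cliqueCount G k < ∑ i ∈ Finset.range (l - 1), ((n + i) / (l - 1)).choose k := by
  intro k l hk hl
  obtain ⟨r, rfl⟩ : ∃ r, l = r + 3 := ⟨l - 3, by omega⟩
  obtain ⟨q₀, hq₀⟩ := eventually_atTop.1 (eventually_choose_lt k hk)
  refine ⟨10 * q₀ * (r + 2), fun n hn => ?_⟩
  rw [show r + 3 - 1 = r + 2 from rfl]
  set x := n / (r + 2) with hx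
  set y := (n + 1) / (r + 2) with hy
  have hxy : x ≤ y := Nat.div_le_div_right (Nat.le_succ n)
  have hyx : y ≤ x + 1 := by
    rw [← Nat.add_div_right n (by omega : 0 < r + 2)]
    exact Nat.div_le_div_right (by omega)
  have hx₀ : 10 * q₀ ≤ x := (Nat.le_div_iff_mul_le (by omega)).2 hn
  have hsplit : ∀ g : ℕ → ℕ, ∑ i ∈ range (r + 2), g ((n + i) / (r + 2)) =
      g x + g y + ∑ j : Fin r, g ((n + (j + 2)) / (r + 2)) := by
    intro g
    rw [sum_range_succ', sum_range_succ', Fin.sum_univ_eq_sum_range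
      (fun j => g ((n + (j + 2)) / (r + 2)))]
    simp only [zero_add, add_zero, add_assoc, Nat.reduceAdd, ← hx, ← hy]
    omega
  let s : Fin 5 ⊕ Fin r → ℕ :=
    Sum.elim (fun c => (x + y + c) / 5) fun j => (n + (j + 2)) / (r + 2)
  have hs : ∑ c, s c = n := by
    have h5 := sum_range_add_div (x + y) 5 (by norm_num)
    rw [← Fin.sum_univ_eq_sum_range (fun i => (x + y + i) / 5)] at h5
    rw [Fintype.sum_sum_type]
    simp only [s, Sum.elim_inl, Sum.elim_inr, h5]
    exact (hsplit id).symm.trans (sum_range_add_div n (r + 2) (by omega))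
  obtain ⟨f, hf⟩ := exists_fin_fiber_card s hs
  refine ⟨cliqueBlowup (pentagonWithIsolated r) f, ?_, ?_⟩
  · have := (indepBound_cycleGraph_five.sum
      (indepBound_card (⊥ : SimpleGraph (Fin r)))).blowup f
    rwa [Fintype.card_fin, add_comm] at this
  · refine (cliqueCount_pentagon_blowup_le (by omega) f s hf).trans_lt ?_
    rw [hsplit fun m => m.choose k]
    refine Nat.add_lt_add_right ?_ _
    obtain ⟨q, hq⟩ : ∃ q, q = (x + y) / 10 := ⟨_, rfl⟩
    have hlo : ∀ c : Fin 5, 2 * q ≤ s (.inl c) := fun c => by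
      simp only [s, Sum.elim_inl]; omega
    have hhi : ∀ c : Fin 5, s (.inl c) ≤ 2 * q + 2 := fun c => by
      simp only [s, Sum.elim_inl]; omega
    have hterm : ∀ c : Fin 5,
        (s (.inl c) + s (.inl (c + 1))).choose k - (s (.inl c)).choose k ≤
          (4 * q + 4).choose k - (2 * q).choose k := fun c =>
      tsub_le_tsub (Nat.choose_le_choose k (by linarith [hhi c, hhi (c + 1)]))
        (Nat.choose_le_choose k (hlo c))
    refine (sum_le_sum fun c _ => hterm c).trans_lt ?_
    have hmain := hq₀ q (by omega)
    have hqx : (5 * q).choose k ≤ x.choose k := Nat.choose_le_choose k (by omega)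
    have hqy : (5 * q).choose k ≤ y.choose k := Nat.choose_le_choose k (by omega)
    have hpos : 0 < (5 * q).choose k := by
      by_contra h
      have h24 := Nat.choose_le_choose k (show 2 * q ≤ 4 * q + 4 by omega)
      omega
    simp only [sum_const, card_univ, Fintype.card_fin, smul_eq_mul]
    omega
end

section
/- For every integer l ≥ 2074 there exists n₀ such that for every n ≥ n₀ there is a simple graph G on n vertices with independence number at most l−1 satisfying t₃(G) < Σ_{i=0}^{l−2} C(⌊(n+i)/(l−1)⌋, 3); that is, the disjoint union of l−1 cliques of nearly-equal sizes is not optimal for the (3,l)-problem when l ≥ 2074. -/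
open Finset

/-- The pairs at which a random function is prescribed to lie in `A` behave independently. -/
theorem card_filter_forall_mem {E β : Type*} [Fintype E] [DecidableEq E] [Fintype β]
    [DecidableEq β] [Nonempty β] (K : Finset E) (A : Finset β) :
    (#{f : E → β | ∀ e ∈ K, f e ∈ A} : ℝ) =
      Fintype.card (E → β) * ((#A : ℝ) / Fintype.card β) ^ #K := by
  have h : ({f : E → β | ∀ e ∈ K, f e ∈ A} : Finset (E → β)) =
      Fintype.piFinset fun e => if e ∈ K then A else univ := by
    ext f
    simp only [mem_filter, mem_univ, true_and, Fintype.mem_piFinset]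
    refine forall_congr' fun e => ?_
    split_ifs with he <;> simp [he]
  have hβ : (Fintype.card β : ℝ) ≠ 0 := by exact_mod_cast Fintype.card_ne_zero
  have hE : Fintype.card E = #K + #Kᶜ := (card_add_card_compl K).symm
  have hp : ∏ e, #(if e ∈ K then A else univ) = #A ^ #K * Fintype.card β ^ #Kᶜ := by
    simp only [apply_ite Finset.card, prod_ite, prod_const, card_univ]
    congr 2
    · simp
    · congr 1; ext; simp
  rw [h, Fintype.card_piFinset, hp, Fintype.card_fun, hE]
  push_cast
  rw [pow_add, div_pow]
  field_simp

/-- The graph whose edges are the pairs mapped to `0`. -/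
def zeroGraph {V : Type*} {b : ℕ} [NeZero b] (f : Sym2 V → Fin b) : SimpleGraph V where
  Adj x y := x ≠ y ∧ f s(x, y) = 0
  symm := ⟨fun x y h => ⟨h.1.symm, by rw [Sym2.eq_swap]; exact h.2⟩⟩
  loopless := ⟨fun _ h => h.1 rfl⟩

/-- `R` holds between all three entries of the triple. -/
def PairwiseRel {W : Type*} (R : W → W → Prop) (t : W × W × W) : Prop :=
  R t.1 t.2.1 ∧ R t.2.1 t.2.2 ∧ R t.1 t.2.2

/-- Equal or adjacent. -/
def EqOrAdj {V : Type*} (G : SimpleGraph V) (x y : V) : Prop := x = y ∨ G.Adj x y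

open Classical in
theorem card_filter_zeroGraph_indep {m b : ℕ} [NeZero b] (s : Finset (Fin m)) :
    (#{f : Sym2 (Fin m) → Fin b | ∀ u ∈ s, ∀ v ∈ s, u ≠ v → ¬ (zeroGraph f).Adj u v} : ℝ) =
      Fintype.card (Sym2 (Fin m) → Fin b) * (1 - 1 / (b : ℝ)) ^ (#s).choose 2 := by
  have hb : (b : ℝ) ≠ 0 := by exact_mod_cast NeZero.ne b
  have h := card_filter_forall_mem (β := Fin b) (s.offDiag.image (Function.uncurry Sym2.mk)) {0}ᶜ
  rw [Sym2.card_image_offDiag, card_compl, card_singleton, Fintype.card_fin,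
    Nat.cast_sub (Nat.one_le_iff_ne_zero.2 (NeZero.ne b)), sub_div, div_self hb,
    Nat.cast_one] at h
  rw [← h]
  congr 2
  ext f
  simp only [mem_filter, mem_univ, true_and, mem_image, mem_offDiag, mem_compl, mem_singleton,
    zeroGraph, not_and]
  constructor
  · rintro h e ⟨⟨u, v⟩, ⟨hu, hv, huv⟩, rfl⟩
    exact h u hu v hv huv huv
  · intro h u hu v hv huv _
    exact h _ ⟨(u, v), ⟨hu, hv, huv⟩, rfl⟩

open Classical in
theorem card_filter_forall_eq_zero {m b : ℕ} [NeZero b] (K : Finset (Sym2 (Fin m))) :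
    (#{f : Sym2 (Fin m) → Fin b | ∀ e ∈ K, f e = 0} : ℝ) =
      Fintype.card (Sym2 (Fin m) → Fin b) * (1 / (b : ℝ)) ^ #K := by
  simpa using card_filter_forall_mem (β := Fin b) K {0}

open Classical in
theorem card_filter_zeroGraph_pairwiseRel_le {m b : ℕ} [NeZero b] (x y z : Fin m) :
    (#{f : Sym2 (Fin m) → Fin b | PairwiseRel (EqOrAdj (zeroGraph f)) (x, y, z)} : ℝ) ≤
      Fintype.card (Sym2 (Fin m) → Fin b) *
        ((if x = y then (if y = z then 1 else 0) else 0) + (if x = y then 1 / (b : ℝ) else 0) +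
          (if y = z then 1 / (b : ℝ) else 0) + (if x = z then 1 / (b : ℝ) else 0) +
          (1 / (b : ℝ)) ^ 3) := by
  have hb : 0 < (1 / (b : ℝ)) := by
    have := NeZero.pos b
    positivity
  have key (K : Finset (Sym2 (Fin m)))
      (hK : ∀ f : Sym2 (Fin m) → Fin b, PairwiseRel (EqOrAdj (zeroGraph f)) (x, y, z) →
        ∀ e ∈ K, f e = 0) :
      (#{f : Sym2 (Fin m) → Fin b | PairwiseRel (EqOrAdj (zeroGraph f)) (x, y, z)} : ℝ) ≤
        Fintype.card (Sym2 (Fin m) → Fin b) * (1 / (b : ℝ)) ^ #K := by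
    rw [← card_filter_forall_eq_zero]
    exact_mod_cast card_le_card fun f hf => by simpa using hK f (by simpa using hf)
  have step {p q : ℝ} (hpq : p ≤ q) : (Fintype.card (Sym2 (Fin m) → Fin b) : ℝ) * p ≤
      Fintype.card (Sym2 (Fin m) → Fin b) * q := by gcongr
  have h3 : 0 < (1 / (b : ℝ)) ^ 3 := by positivity
  by_cases hxy : x = y <;> by_cases hyz : y = z
  · subst hxy hyz
    refine (key ∅ (by simp)).trans (step ?_)
    simp only [card_empty, pow_zero, if_true]
    linarith
  · subst hxy
    refine (key {s(x, z)} fun f hf => ?_).trans (step ?_)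
    · simpa using (hf.2.1.resolve_left hyz).2
    · simp only [card_singleton, pow_one, if_true, hyz, if_false]
      linarith
  · subst hyz
    refine (key {s(x, y)} fun f hf => ?_).trans (step ?_)
    · simpa using (hf.1.resolve_left hxy).2
    · simp only [card_singleton, pow_one, if_true, hxy, if_false]
      linarith
  · by_cases hxz : x = z
    · subst hxz
      refine (key {s(x, y)} fun f hf => ?_).trans (step ?_)
      · simpa using (hf.1.resolve_left hxy).2
      · simp only [card_singleton, pow_one, if_true, hxy, hyz, if_false]
        linarith
    · have hc : #({s(x, y), s(y, z), s(x, z)} : Finset (Sym2 (Fin m))) = 3 := by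
        rw [card_eq_three]
        refine ⟨_, _, _, ?_, ?_, ?_, rfl⟩ <;> simp <;> grind
      refine (key {s(x, y), s(y, z), s(x, z)} fun f hf => ?_).trans (step ?_)
      · simpa using ⟨(hf.1.resolve_left hxy).2, (hf.2.1.resolve_left hyz).2,
          (hf.2.2.resolve_left hxz).2⟩
      · rw [hc]
        simp [hxy, hyz, hxz]

open Classical in
/-- First moment method for the random graph with edge probability `1 / b`. -/
theorem exists_graph_of_first_moment {m b k : ℕ} [NeZero b] {T : ℝ} (hT : 0 < T)
    (h : (m + 3 * m ^ 2 / b + m ^ 3 / b ^ 3 : ℝ) / T +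
      m.choose k * (1 - 1 / (b : ℝ)) ^ k.choose 2 < 1) :
    ∃ G : SimpleGraph (Fin m),
      (∀ s : Finset (Fin m), (∀ u ∈ s, ∀ v ∈ s, u ≠ v → ¬ G.Adj u v) → #s ≠ k) ∧
      (#{t | PairwiseRel (EqOrAdj G) t} : ℝ) < T := by
  by_contra! hG
  set Ω := Sym2 (Fin m) → Fin b
  have hN : (0 : ℝ) < Fintype.card Ω := by exact_mod_cast Fintype.card_pos
  have hone (f : Ω) : (1 : ℝ) ≤
      (∑ t, if PairwiseRel (EqOrAdj (zeroGraph f)) t then (1 : ℝ) else 0) / T +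
      ∑ s ∈ powersetCard k (univ : Finset (Fin m)),
        if ∀ u ∈ s, ∀ v ∈ s, u ≠ v → ¬ (zeroGraph f).Adj u v then (1 : ℝ) else 0 := by
    by_cases hs : ∃ s : Finset (Fin m),
        (∀ u ∈ s, ∀ v ∈ s, u ≠ v → ¬ (zeroGraph f).Adj u v) ∧ #s = k
    · obtain ⟨s, hs, hk⟩ := hs
      have h0 : 0 ≤ (∑ t, if PairwiseRel (EqOrAdj (zeroGraph f)) t then (1 : ℝ) else 0) / T :=
        div_nonneg (sum_nonneg fun _ _ => by positivity) hT.le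
      have h1 := single_le_sum (s := powersetCard k (univ : Finset (Fin m)))
        (f := fun s => if ∀ u ∈ s, ∀ v ∈ s, u ≠ v → ¬ (zeroGraph f).Adj u v
          then (1 : ℝ) else 0) (fun _ _ => by positivity) (a := s) (by simp [hk])
      simp only [if_pos hs] at h1
      linarith
    · push Not at hs
      have h2 := hG (zeroGraph f) (by simpa using hs)
      rw [← natCast_card_filter]
      have h0 : (1 : ℝ) ≤ #{t | PairwiseRel (EqOrAdj (zeroGraph f)) t} / T :=
        (one_le_div hT).2 h2
      have h1 : (0 : ℝ) ≤ ∑ s ∈ powersetCard k (univ : Finset (Fin m)),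
        if ∀ u ∈ s, ∀ v ∈ s, u ≠ v → ¬ (zeroGraph f).Adj u v then (1 : ℝ) else 0 :=
        sum_nonneg fun _ _ => by positivity
      linarith
  have hsum := sum_le_sum fun f (_ : f ∈ (univ : Finset Ω)) => hone f
  rw [sum_add_distrib, ← sum_div, sum_comm, sum_comm (s := univ)
    (t := powersetCard k (univ : Finset (Fin m)))] at hsum
  simp only [← natCast_card_filter, sum_const, card_univ, nsmul_eq_mul, mul_one] at hsum
  have hI : ∑ s ∈ powersetCard k (univ : Finset (Fin m)),
      (#{f : Ω | ∀ u ∈ s, ∀ v ∈ s, u ≠ v → ¬ (zeroGraph f).Adj u v} : ℝ) =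
      Fintype.card Ω * (m.choose k * (1 - 1 / (b : ℝ)) ^ k.choose 2) := by
    rw [sum_congr rfl fun s hs => by
      rw [card_filter_zeroGraph_indep, (mem_powersetCard.1 hs).2]]
    simp only [sum_const, card_powersetCard, card_univ, Fintype.card_fin, nsmul_eq_mul]
    ring
  have hS : ∑ t : Fin m × Fin m × Fin m,
      (#{f : Ω | PairwiseRel (EqOrAdj (zeroGraph f)) t} : ℝ) ≤
      Fintype.card Ω * (m + 3 * m ^ 2 / b + m ^ 3 / b ^ 3) := by
    refine (sum_le_sum fun t _ => card_filter_zeroGraph_pairwiseRel_le t.1 t.2.1 t.2.2).trans ?_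
    rw [← mul_sum]
    refine mul_le_mul_of_nonneg_left (le_of_eq ?_) hN.le
    have hxy : ∑ x : Fin m, ∑ y, ∑ _z : Fin m, (if x = y then 1 / (b : ℝ) else 0) =
        m ^ 2 * (1 / b) := by
      simp only [sum_const, nsmul_eq_mul, ← mul_sum, sum_ite_eq, mem_univ, if_true, card_univ,
        Fintype.card_fin]
      ring
    simp only [Fintype.sum_prod_type, sum_add_distrib, hxy]
    simp [sum_ite_irrel]
    ring
  have hS' := div_le_div_of_nonneg_right hS hT.le
  have := mul_lt_mul_of_pos_left h hN
  rw [hI] at hsum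
  rw [mul_add, ← mul_div_assoc] at this
  linarith

set_option exponentiation.threshold 100000 in
theorem choose_mul_pow_le :
    (Nat.choose 162000 2074 : ℝ) * (1 - 1 / 194) ^ Nat.choose 2074 2 ≤ 1 / 10 ^ 4 := by
  have h1 : ((1 : ℝ) - 1 / 194) ^ 1037 ≤ 47047386522243 / 10 ^ 16 := by
    rw [show (1 : ℝ) - 1 / 194 = 193 / 194 by norm_num, div_pow, div_le_div_iff₀] <;> norm_num
  have h2 : Nat.descFactorial 162000 2074 * 47047386522243 ^ 2073 * 10 ^ 4 ≤
      (10 ^ 16) ^ 2073 * Nat.factorial 2074 := by norm_num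
  have h3 : (Nat.factorial 2074 : ℝ) * Nat.choose 162000 2074 = Nat.descFactorial 162000 2074 := by
    exact_mod_cast (Nat.descFactorial_eq_factorial_mul_choose _ _).symm
  have h4 : (0 : ℝ) < Nat.factorial 2074 := by exact_mod_cast Nat.factorial_pos _
  have h5 : Nat.choose 2074 2 = 1037 * 2073 := by norm_num [Nat.choose_two_right]
  calc
    _ = (Nat.choose 162000 2074 : ℝ) * ((1 - 1 / 194) ^ 1037) ^ 2073 :=
      congrArg _ ((congrArg _ h5).trans (pow_mul _ _ _))
    _ ≤ (Nat.choose 162000 2074 : ℝ) * (47047386522243 / 10 ^ 16) ^ 2073 :=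
      mul_le_mul_of_nonneg_left (pow_le_pow_left₀ (pow_nonneg (by norm_num) _) h1 _)
        (Nat.cast_nonneg _)
    _ ≤ 1 / 10 ^ 4 := by
      rw [div_pow, mul_div_assoc', div_le_div_iff₀ (by positivity) (by positivity), one_mul]
      refine le_of_mul_le_mul_left ?_ h4
      rw [← mul_assoc, ← mul_assoc, h3, mul_comm (Nat.factorial 2074 : ℝ)]
      have h6 := (Nat.cast_le (α := ℝ)).2 h2
      rw [Nat.cast_mul, Nat.cast_mul, Nat.cast_mul, Nat.cast_pow, Nat.cast_pow, Nat.cast_pow,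
        Nat.cast_pow, Nat.cast_ofNat, Nat.cast_ofNat] at h6
      exact h6

/-- Vertices are joined when their images under `c` are related by `R`. -/
def blowUp {V W : Type*} (R : W → W → Prop) [Std.Symm R] (c : V → W) : SimpleGraph V where
  Adj x y := x ≠ y ∧ R (c x) (c y)
  symm := ⟨fun _ _ h => ⟨h.1.symm, symm_of R h.2⟩⟩
  loopless := ⟨fun _ h => h.1 rfl⟩

open Classical in
theorem six_mul_cliqueCount_le {V : Type*} [Fintype V] (G : SimpleGraph V) :
    6 * cliqueCount G 3 ≤ #{t : V × V × V | PairwiseRel G.Adj t} := by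
  have hc : cliqueCount G 3 = #{s : Finset V | #s = 3 ∧ G.IsClique (s : Set V)} := by
    rw [cliqueCount, Nat.card_eq_fintype_card, Fintype.card_subtype]
  rw [hc, mul_comm, ← smul_eq_mul, ← sum_const]
  rw [card_eq_sum_card_fiberwise (f := fun t : V × V × V => ({t.1, t.2.1, t.2.2} : Finset V))
    (t := {s : Finset V | #s = 3 ∧ G.IsClique (s : Set V)})]
  · refine sum_le_sum fun s hs => ?_
    obtain ⟨h3, hcl⟩ := (mem_filter.1 hs).2
    obtain ⟨x, y, z, hxy, hxz, hyz, rfl⟩ := card_eq_three.1 h3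
    have h6 : #({(x, y, z), (x, z, y), (y, x, z), (y, z, x), (z, x, y), (z, y, x)} :
        Finset (V × V × V)) = 6 := by
      simp [card_insert_of_notMem, hxy, hxz, hyz, hxy.symm, hxz.symm, hyz.symm]
    rw [← h6]
    refine card_le_card fun t ht => ?_
    have a1 : G.Adj x y := hcl (by simp) (by simp) hxy
    have a2 : G.Adj x z := hcl (by simp) (by simp) hxz
    have a3 : G.Adj y z := hcl (by simp) (by simp) hyz
    simp only [mem_insert, mem_singleton] at ht
    rw [mem_filter, mem_filter]
    rcases ht with rfl | rfl | rfl | rfl | rfl | rfl <;>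
      refine ⟨⟨mem_univ _, by simp [PairwiseRel, a1, a2, a3, a1.symm, a2.symm, a3.symm]⟩, ?_⟩ <;>
      ext w <;> simp only [mem_insert, mem_singleton] <;> clear * - <;> grind
  · rintro ⟨x, y, z⟩ ht
    obtain ⟨a1, a2, a3⟩ := (mem_filter.1 ht).2
    simp only [coe_filter, mem_univ, true_and, Set.mem_ofPred_eq]
    have := SimpleGraph.is3Clique_triple_iff.2 ⟨a1, a3, a2⟩
    exact ⟨this.card_eq, this.isClique⟩

open Classical in
theorem six_mul_cliqueCount_blowUp_le {V W : Type*} [Fintype V] [Fintype W] {R : W → W → Prop}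
    [Std.Symm R] (c : V → W) {t : ℕ} (hc : ∀ w, #{v | c v = w} ≤ t) :
    6 * cliqueCount (blowUp R c) 3 ≤ #{w | PairwiseRel R w} * t ^ 3 := by
  refine (six_mul_cliqueCount_le _).trans ?_
  rw [mul_comm]
  refine card_le_mul_card_image_of_maps_to (f := fun v => (c v.1, c v.2.1, c v.2.2)) ?_ _ ?_
  · rintro ⟨x, y, z⟩ h
    obtain ⟨a1, a2, a3⟩ := (mem_filter.1 h).2
    simpa using ⟨a1.2, a2.2, a3.2⟩
  · rintro ⟨w₁, w₂, w₃⟩ -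
    calc
      _ ≤ #(({v | c v = w₁} : Finset V) ×ˢ ({v | c v = w₂} : Finset V) ×ˢ
          ({v | c v = w₃} : Finset V)) := by
        refine card_le_card fun v hv => ?_
        simpa using (mem_filter.1 hv).2
      _ ≤ t ^ 3 := by
        rw [card_product, card_product, pow_three]
        gcongr <;> apply hc

/-- The blow-up of `F` with every vertex replaced by a clique on `A`, together with disjoint cliques on
`U` indexed by `B`. -/
def joinedRel {U A B : Type*} (F : SimpleGraph U) : (U × A) ⊕ (U × B) → (U × A) ⊕ (U × B) → Prop
  | .inl p, .inl q => EqOrAdj F p.1 q.1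
  | .inr p, .inr q => p.2 = q.2
  | _, _ => False

instance joinedRel_symm {U A B : Type*} (F : SimpleGraph U) :
    Std.Symm (joinedRel (A := A) (B := B) F) := by
  constructor
  rintro (p | p) (q | q) h
  · exact h.imp Eq.symm SimpleGraph.Adj.symm
  · exact h
  · exact h
  · exact Eq.symm h

theorem joinedRel_refl {U A B : Type*} (F : SimpleGraph U) (w : (U × A) ⊕ (U × B)) :
    joinedRel F w w := by
  rcases w with p | p
  · exact .inl rfl
  · exact rfl

open Classical in
theorem card_pairwiseRel_joinedRel_le {U A B : Type*} [Fintype U] [Fintype A] [Fintype B]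
    (F : SimpleGraph U) :
    #{w | PairwiseRel (joinedRel (A := A) (B := B) F) w} ≤
      Fintype.card A ^ 3 * #{t | PairwiseRel (EqOrAdj F) t} +
        Fintype.card B * Fintype.card U ^ 3 := by
  let φ : (A × A × A) × (U × U × U) →
      ((U × A) ⊕ (U × B)) × ((U × A) ⊕ (U × B)) × ((U × A) ⊕ (U × B)) := fun x =>
    (.inl (x.2.1, x.1.1), .inl (x.2.2.1, x.1.2.1), .inl (x.2.2.2, x.1.2.2))
  let ψ : B × (U × U × U) →
      ((U × A) ⊕ (U × B)) × ((U × A) ⊕ (U × B)) × ((U × A) ⊕ (U × B)) := fun x =>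
    (.inr (x.2.1, x.1), .inr (x.2.2.1, x.1), .inr (x.2.2.2, x.1))
  calc
    _ ≤ #((univ ×ˢ ({t | PairwiseRel (EqOrAdj F) t} : Finset _)).image φ ∪ univ.image ψ) := by
      refine card_le_card ?_
      rintro ⟨p | p, q | q, r | r⟩ h <;> obtain ⟨h1, h2, h3⟩ := (mem_filter.1 h).2 <;>
        simp only [joinedRel] at h1 h2 h3
      · refine mem_union_left _ (mem_image.2 ⟨((p.2, q.2, r.2), (p.1, q.1, r.1)), ?_, rfl⟩)
        simpa using ⟨h1, h2, h3⟩
      · refine mem_union_right _ (mem_image.2 ⟨(p.2, (p.1, q.1, r.1)), mem_univ _, ?_⟩)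
        simp [ψ, h1, h2, Prod.ext_iff]
    _ ≤ _ := by
      refine (card_union_le _ _).trans (add_le_add (card_image_le.trans_eq ?_)
        (card_image_le.trans_eq ?_))
      · rw [card_product, card_univ, Fintype.card_prod, Fintype.card_prod]
        ring
      · rw [card_univ, Fintype.card_prod, Fintype.card_prod, Fintype.card_prod]
        ring

open Classical in
theorem card_le_of_joinedRel_indep {U A B : Type*} [Fintype B] {F : SimpleGraph U} {a : ℕ}
    (hF : ∀ s : Finset U, (∀ u ∈ s, ∀ v ∈ s, u ≠ v → ¬ F.Adj u v) → #s ≤ a)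
    (S : Finset ((U × A) ⊕ (U × B))) (hS : ∀ p ∈ S, ∀ q ∈ S, p ≠ q → ¬ joinedRel F p q) :
    #S ≤ a + Fintype.card B := by
  rw [← card_toLeft_add_card_toRight]
  have hl (p) (hp : p ∈ S.toLeft) (q) (hq : q ∈ S.toLeft) (h : EqOrAdj F p.1 q.1) : p = q := by
    by_contra hpq
    exact hS _ (mem_toLeft.1 hp) _ (mem_toLeft.1 hq) (by simpa using hpq) h
  have hr (p) (hp : p ∈ S.toRight) (q) (hq : q ∈ S.toRight) (h : p.2 = q.2) : p = q := by
    by_contra hpq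
    exact hS _ (mem_toRight.1 hp) _ (mem_toRight.1 hq) (by simpa using hpq) h
  refine add_le_add ?_ ?_
  · rw [← card_image_of_injOn (f := Prod.fst) fun p hp q hq h => hl p hp q hq (.inl h)]
    refine hF _ fun u hu v hv huv hadj => ?_
    obtain ⟨p, hp, rfl⟩ := mem_image.1 hu
    obtain ⟨q, hq, rfl⟩ := mem_image.1 hv
    exact huv (congrArg Prod.fst (hl p hp q hq (.inr hadj)))
  · exact card_le_card_of_injOn (t := univ) Prod.snd (by simp) fun p hp q hq h => hr p hp q hq h

open Classical in
/-- A map to a finite type all of whose fibres have nearly equal size. -/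
theorem exists_map_card_fiber_le (W : Type*) [Fintype W] [Nonempty W] (n : ℕ) :
    ∃ c : Fin n → W, ∀ w, #{v | c v = w} ≤ n / Fintype.card W + 1 := by
  have hM : 0 < Fintype.card W := Fintype.card_pos
  let e := Fintype.equivFin W
  refine ⟨fun v => e.symm ⟨v % Fintype.card W, Nat.mod_lt _ hM⟩, fun w => ?_⟩
  calc
    _ ≤ #(range (n / Fintype.card W + 1)) := by
      refine card_le_card_of_injOn (fun v => v / Fintype.card W) ?_ ?_
      · intro v _
        simpa [Nat.lt_succ_iff] using Nat.div_le_div_right v.2.le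
      · intro u hu v hv h
        simp only [coe_filter, mem_univ, true_and, Set.mem_ofPred_eq, Equiv.symm_apply_eq] at hu hv
        have h1 := congrArg Fin.val (hu.trans hv.symm)
        ext
        rw [← Nat.div_add_mod (u : ℕ) (Fintype.card W), ← Nat.div_add_mod (v : ℕ) (Fintype.card W)]
        simp only at h1 h
        rw [h1, h]
    _ = _ := card_range _

theorem mul_descFactorial_le_six_mul_sum_choose {n L q : ℕ} (hq : q * L ≤ n) :
    L * q.descFactorial 3 ≤ 6 * ∑ i ∈ range L, ((n + i) / L).choose 3 := by
  rw [Nat.descFactorial_eq_factorial_mul_choose, mul_left_comm]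
  refine Nat.mul_le_mul_left 6 ?_
  rw [← smul_eq_mul]
  conv_lhs => rw [← card_range L]
  refine card_nsmul_le_sum _ _ _ fun i hi => Nat.choose_le_choose 3 ?_
  rw [Nat.le_div_iff_mul_le (Nat.zero_lt_of_lt (mem_range.1 hi))]
  omega

theorem mul_succ_pow_lt_mul_descFactorial {K L m s : ℕ} (hK : K < m ^ 3 * L)
    (hs : 10 * (m ^ 3 * L) ≤ s) : K * (s + 1) ^ 3 < L * (m * s).descFactorial 3 := by
  have hm : 1 ≤ m := Nat.pos_of_ne_zero fun h => by simp [h] at hK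
  have hs1 : 10 ≤ s := by omega
  have hms : 10 ≤ m * s := hs1.trans (Nat.le_mul_of_pos_left _ hm)
  have hd : ((m * s).descFactorial 3 : ℤ) = (m * s) * (m * s - 1) * (m * s - 2) := by
    simp only [Nat.descFactorial, mul_one, Nat.sub_zero]
    push_cast [Nat.cast_sub (show 1 ≤ m * s by omega), Nat.cast_sub (show 2 ≤ m * s by omega)]
    ring
  have hDm : m ^ 2 * L ≤ m ^ 3 * L := by gcongr; omega
  zify at *
  rw [hd]
  set D : ℤ := m ^ 3 * L with hD
  have h1 : (K : ℤ) * (s + 1) ^ 3 ≤ (D - 1) * (s + 1) ^ 3 := by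
    gcongr; omega
  have h2 : D * s ^ 3 - 3 * D * s ^ 2 ≤ L * ((m * s) * (m * s - 1) * (m * s - 2) : ℤ) := by
    have e : (L * ((m * s) * (m * s - 1) * (m * s - 2)) : ℤ) =
        D * s ^ 3 - 3 * (m ^ 2 * L) * s ^ 2 + 2 * (L * (m * s)) := by rw [hD]; ring
    have : (m ^ 2 * L * s ^ 2 : ℤ) ≤ D * s ^ 2 := by gcongr
    have : (0 : ℤ) ≤ L * (m * s) := by positivity
    rw [e]; linarith
  have hD1 : 1 ≤ D := by omega
  nlinarith [mul_le_mul_of_nonneg_right hs (sq_nonneg (s : ℤ)),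
    mul_nonneg (sub_nonneg.2 hD1) (show (0 : ℤ) ≤ s ^ 2 - s by nlinarith),
    mul_nonneg (sub_nonneg.2 hD1) (show (0 : ℤ) ≤ s ^ 2 - 1 by nlinarith), sq_nonneg (s : ℤ)]

open Classical in
/-- A graph with independence number at most `2073` and few triangles. -/
theorem exists_graph_indepBound_card_pairwiseRel_lt :
    ∃ (m : ℕ) (F : SimpleGraph (Fin m)), IndepBound F 2073 ∧
      #{t | PairwiseRel (EqOrAdj F) t} * 2073 ^ 2 < m ^ 3 := by
  have h := choose_mul_pow_le
  obtain ⟨F, hF, hT⟩ := exists_graph_of_first_moment (m := 162000) (b := 194) (k := 2074)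
    (T := 162000 ^ 3 / 2073 ^ 2) (by norm_num) (by
      refine (add_le_add_right h _).trans_lt ?_
      norm_num)
  refine ⟨162000, F, fun s hs => ?_, ?_⟩
  · refine Nat.lt_succ_iff.1 (lt_of_not_ge fun hc => ?_)
    obtain ⟨r, hrs, hr⟩ := exists_subset_card_eq hc
    exact hF r (fun u hu v hv => hs u (hrs hu) v (hrs hv)) hr
  · rw [lt_div_iff₀ (by norm_num)] at hT
    exact_mod_cast hT

theorem indepBound_blowUp {V W : Type*} {R : W → W → Prop} [Std.Symm R] (hR : ∀ w, R w w)
    (c : V → W) {a : ℕ}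
    (h : ∀ S : Finset W, (∀ p ∈ S, ∀ q ∈ S, p ≠ q → ¬ R p q) → #S ≤ a) :
    IndepBound (blowUp R c) a := by
  classical
  intro s hs
  have hinj (u) (hu : u ∈ s) (v) (hv : v ∈ s) (huv : R (c u) (c v)) : u = v := by
    by_contra hne
    exact hs u hu v hv hne ⟨hne, huv⟩
  rw [← card_image_of_injOn (f := c) fun u hu v hv huv =>
    hinj u hu v hv (huv ▸ hR (c u))]
  refine h _ fun p hp q hq hpq hr => ?_
  obtain ⟨u, hu, rfl⟩ := mem_image.1 hp
  obtain ⟨v, hv, rfl⟩ := mem_image.1 hq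
  exact hpq (congrArg c (hinj u hu v hv hr))

/-- For l ≥ 2074, the disjoint union of l−1 nearly-equal cliques is not optimal for the
(3,l)-problem: for large n there is a graph on n vertices with independence number at
most l−1 and strictly fewer triangles than Σ_{i<l−1} C(⌊(n+i)/(l−1)⌋,3). -/
theorem turan_complement_not_optimal_triangles :
    ∀ l : ℕ, 2074 ≤ l →
      ∃ n₀ : ℕ, ∀ n : ℕ, n₀ ≤ n →
        ∃ G : SimpleGraph (Fin n), IndepBound G (l - 1) ∧
          cliqueCount G 3 < ∑ i ∈ Finset.range (l - 1), ((n + i) / (l - 1)).choose 3 := by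
  classical
  intro l hl
  obtain ⟨m, F, hF, hcard⟩ := exists_graph_indepBound_card_pairwiseRel_lt
  have hm : 0 < m := Nat.pos_of_ne_zero fun h => by simp [h] at hcard
  obtain ⟨d, rfl⟩ := Nat.exists_eq_add_of_le' hl
  have : NeZero m := ⟨hm.ne'⟩
  let W := (Fin m × Fin 2073) ⊕ (Fin m × Fin d)
  have hW : Fintype.card W = m * (2073 + d) := by simp [W, mul_add]
  have hL : d + 2074 - 1 = 2073 + d := by omega
  rw [hL]
  refine ⟨10 * (m ^ 3 * (2073 + d)) * (m * (2073 + d)), fun n hn => ?_⟩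
  obtain ⟨c, hc⟩ := exists_map_card_fiber_le W n
  rw [hW] at hc
  refine ⟨blowUp (joinedRel F) c, indepBound_blowUp (joinedRel_refl F) c fun S hS => ?_, ?_⟩
  · simpa using card_le_of_joinedRel_indep hF S hS
  · have hs : 10 * (m ^ 3 * (2073 + d)) ≤ n / (m * (2073 + d)) :=
      (Nat.le_div_iff_mul_le (by positivity)).2 hn
    have hK := card_pairwiseRel_joinedRel_le (A := Fin 2073) (B := Fin d) F
    simp only [Fintype.card_fin] at hK
    refine Nat.lt_of_mul_lt_mul_left (a := 6) ?_
    calc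
      _ ≤ _ := six_mul_cliqueCount_blowUp_le c hc
      _ < _ := mul_succ_pow_lt_mul_descFactorial (by linarith) hs
      _ ≤ _ := mul_descFactorial_le_six_mul_sum_choose <| by
        rw [mul_right_comm, mul_comm (m * _)]
        exact Nat.div_mul_le_self _ _
end

section
/- Let m ≥ 1 and let G be the blow-up of the 5-cycle C₅ with all five parts of size m: the vertex set is partitioned into V₁,...,V₅ with |V_i| = m, and two distinct vertices are adjacent if and only if they lie in the same part or in cyclically consecutive parts V_i, V_{i+1} (indices modulo 5). Then G has independence number exactly 2, and for every k ≥ 1 the number of k-cliques of G equals 5·(C(2m,k) − C(m,k)). -/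
/-- a set of pairwise nonadjacent vertices. -/
def IsIndepFinset {V : Type*} (G : SimpleGraph V) (s : Finset V) : Prop :=
  ∀ u ∈ s, ∀ v ∈ s, u ≠ v → ¬ G.Adj u v

/-- the union of the parts of `Fin n × Fin m` with index in `T`. -/
def partsUnion {n : ℕ} (m : ℕ) (T : Finset (Fin n)) : Finset (Fin n × Fin m) :=
  T ×ˢ Finset.univ

theorem card_partsUnion {n : ℕ} (m : ℕ) (T : Finset (Fin n)) :
    (partsUnion m T).card = T.card * m := by
  simp [partsUnion]

theorem subset_partsUnion_iff {n m : ℕ} (T : Finset (Fin n)) (s : Finset (Fin n × Fin m)) :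
    s ⊆ partsUnion m T ↔ s.image Prod.fst ⊆ T := by
  simp [partsUnion, Finset.subset_iff]

theorem card_le_two_of_indep_c5 :
    ∀ T : Finset (Fin 5), (∀ a ∈ T, ∀ b ∈ T, a ≠ b → ¬ (a = b + 1 ∨ b = a + 1)) →
      T.card ≤ 2 := by
  decide

theorem clique_c5_iff :
    ∀ T : Finset (Fin 5), T.Nonempty →
      ((∀ a ∈ T, ∀ b ∈ T, a = b ∨ a = b + 1 ∨ b = a + 1) ↔
        ∃ i, T ⊆ {i, i + 1} ∧ ¬ T ⊆ {i + 1}) := by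
  decide

theorem clique_c5_unique :
    ∀ (T : Finset (Fin 5)) (i j : Fin 5), T ⊆ {i, i + 1} → ¬ T ⊆ {i + 1} →
      T ⊆ {j, j + 1} → ¬ T ⊆ {j + 1} → i = j := by
  decide

/-- the `k`-subsets of the `i`-th and `(i+1)`-st parts that meet the `i`-th part. -/
def cliquesAt (m k : ℕ) (i : Fin 5) : Finset (Finset (Fin 5 × Fin m)) :=
  Finset.powersetCard k (partsUnion m {i, i + 1}) \ Finset.powersetCard k (partsUnion m {i + 1})

theorem mem_cliquesAt {m k : ℕ} {i : Fin 5} {s : Finset (Fin 5 × Fin m)} :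
    s ∈ cliquesAt m k i ↔ s.card = k ∧ s.image Prod.fst ⊆ {i, i + 1} ∧
      ¬ s.image Prod.fst ⊆ {i + 1} := by
  simp only [cliquesAt, Finset.mem_sdiff, Finset.mem_powersetCard, subset_partsUnion_iff]
  tauto

theorem card_cliquesAt (m k : ℕ) (i : Fin 5) :
    (cliquesAt m k i).card = (2 * m).choose k - m.choose k := by
  have h : partsUnion m {i + 1} ⊆ partsUnion m {i, i + 1} :=
    Finset.product_subset_product_left (by simp)
  have h2 : ({i, i + 1} : Finset (Fin 5)).card = 2 :=
    Finset.card_pair (by simp)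
  rw [cliquesAt, Finset.card_sdiff_of_subset (Finset.powersetCard_mono h),
    Finset.card_powersetCard, Finset.card_powersetCard, card_partsUnion, card_partsUnion, h2,
    Finset.card_singleton, one_mul]

theorem card_biUnion_cliquesAt (m k : ℕ) :
    (Finset.univ.biUnion (cliquesAt m k)).card = 5 * ((2 * m).choose k - m.choose k) := by
  rw [Finset.card_biUnion]
  · simp [card_cliquesAt]
  · intro i _ j _ hij
    refine Finset.disjoint_left.2 fun s hi hj => ?_
    rw [mem_cliquesAt] at hi hj
    exact hij (clique_c5_unique _ i j hi.2.1 hi.2.2 hj.2.1 hj.2.2)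

/-- Let m ≥ 1 and let G be the balanced blow-up of C₅ with parts V₁,…,V₅ of size m:
vertices are pairs (i,a) ∈ Fin 5 × Fin m, and two distinct vertices are adjacent iff
their parts are equal or cyclically consecutive.  Then α(G) = 2 and, for every k ≥ 1,
G has exactly 5·(C(2m,k) − C(m,k)) k-cliques. -/
theorem c5_blowup_cliques_and_independence :
    ∀ m : ℕ, 1 ≤ m → ∀ G : SimpleGraph (Fin 5 × Fin m),
      (∀ p q : Fin 5 × Fin m,
        G.Adj p q ↔ p ≠ q ∧ (p.1 = q.1 ∨ p.1 = q.1 + 1 ∨ q.1 = p.1 + 1)) →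
      ((∀ s : Finset (Fin 5 × Fin m), IsIndepFinset G s → s.card ≤ 2) ∧
        (∃ s : Finset (Fin 5 × Fin m), IsIndepFinset G s ∧ s.card = 2) ∧
        ∀ k : ℕ, 1 ≤ k →
          cliqueCount G k = 5 * ((2 * m).choose k - m.choose k)) := by
  intro m hm G hG
  refine ⟨fun s hs => ?_, ?_, fun k hk => ?_⟩
  · have hinj : Set.InjOn Prod.fst (s : Set (Fin 5 × Fin m)) := by
      intro p hp q hq hpq
      by_contra hne
      exact hs p hp q hq hne ((hG p q).2 ⟨hne, Or.inl hpq⟩)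
    rw [← Finset.card_image_of_injOn hinj]
    refine card_le_two_of_indep_c5 _ fun a ha b hb hab h => ?_
    obtain ⟨p, hp, rfl⟩ := Finset.mem_image.1 ha
    obtain ⟨q, hq, rfl⟩ := Finset.mem_image.1 hb
    have hne : p ≠ q := fun e => hab (congrArg Prod.fst e)
    exact hs p hp q hq hne ((hG p q).2 ⟨hne, Or.inr h⟩)
  · refine ⟨{(0, ⟨0, hm⟩), (2, ⟨0, hm⟩)}, ?_, Finset.card_pair (by simp)⟩
    intro u hu v hv huv
    simp only [Finset.mem_insert, Finset.mem_singleton] at hu hv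
    rw [hG]
    rcases hu with rfl | rfl <;> rcases hv with rfl | rfl <;> first
      | exact absurd rfl huv
      | (rintro ⟨-, h⟩
         simp [Fin.ext_iff] at h)
  · rw [← card_biUnion_cliquesAt, cliqueCount]
    refine Nat.subtype_card _ fun s => ?_
    simp only [Finset.mem_biUnion, Finset.mem_univ, true_and, mem_cliquesAt, exists_and_left]
    refine and_congr_right fun hs => ?_
    have hne : s.Nonempty := Finset.card_pos.1 (by omega)
    rw [← clique_c5_iff _ (hne.image _)]
    simp only [Finset.forall_mem_image]
    constructor
    · intro h p hp q hq hpq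
      exact (hG p q).2 ⟨hpq, h hp hq⟩
    · intro h p hp q hq
      by_cases hpq : p = q
      · exact Or.inl (congrArg Prod.fst hpq)
      · exact ((hG p q).1 (h hp hq hpq)).2
end

section
/- There exists a positive integer m and a simple graph G on m vertices with no independent set of size 2074 such that e(G) + t₃(G) < m³/(6·2073²) − m/6, where e(G) is the number of edges of G and t₃(G) the number of triangles of G. -/
/-- the number of edges of `G`. -/
noncomputable def edgeCount {V : Type*} [Fintype V] (G : SimpleGraph V) : ℕ :=
  G.edgeSet.ncard

open Finset

section RandomGraph

variable {V : Type*}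

/-- The unordered pairs of distinct elements of `s`. -/
def distinctPairs [DecidableEq V] (s : Finset V) : Finset (Sym2 V) :=
  s.offDiag.image Sym2.mk.uncurry

lemma card_distinctPairs [DecidableEq V] (s : Finset V) : #(distinctPairs s) = (#s).choose 2 :=
  Sym2.card_image_offDiag s

lemma forall_mem_distinctPairs [DecidableEq V] {s : Finset V} {P : Sym2 V → Prop} :
    (∀ e ∈ distinctPairs s, P e) ↔ ∀ u ∈ s, ∀ v ∈ s, u ≠ v → P s(u, v) := by
  simp only [distinctPairs, mem_image, mem_offDiag, Prod.exists, Function.uncurry_apply_pair]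
  grind

/-- The graph whose edges are the pairs of distinct vertices with value `true`. -/
def graphOf (f : Sym2 V → Bool) : SimpleGraph V :=
  SimpleGraph.fromEdgeSet {e | f e = true}

lemma graphOf_adj {f : Sym2 V → Bool} {u v : V} :
    (graphOf f).Adj u v ↔ f s(u, v) = true ∧ u ≠ v := by
  simp [graphOf]

variable [Fintype V] [DecidableEq V]

/-- The `j`-element vertex sets all of whose pairs receive the value `b` under `f`. -/
def monoSets (f : Sym2 V → Bool) (b : Bool) (j : ℕ) : Finset (Finset V) :=
  {s ∈ powersetCard j univ | ∀ e ∈ distinctPairs s, f e = b}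

lemma sum_weight_forall_mem {ι : Type*} [Fintype ι] [DecidableEq ι] {w : Bool → ℝ}
    (hw : ∑ b, w b = 1) (S : Finset ι) (b : Bool) :
    ∑ f : ι → Bool, (∏ e, w (f e)) * (if ∀ e ∈ S, f e = b then 1 else 0) = w b ^ #S := by
  have key (f : ι → Bool) : (∏ e, w (f e)) * (if ∀ e ∈ S, f e = b then 1 else 0) =
      ∏ e, (if e ∈ S then (if f e = b then w (f e) else 0) else w (f e)) := by
    split_ifs with h
    · rw [mul_one]
      exact prod_congr rfl fun e _ ↦ by grind
    · push Not at h
      obtain ⟨e, he, hb⟩ := h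
      rw [mul_zero, prod_eq_zero (mem_univ e)]
      simp [he, hb]
  have hsum (e : ι) : ∑ c, (if e ∈ S then (if c = b then w c else 0) else w c) =
      if e ∈ S then w b else 1 := by
    split_ifs
    · simp
    · exact hw
  simp_rw [key]
  rw [← Fintype.prod_sum (f := fun e c ↦ if e ∈ S then (if c = b then w c else 0) else w c)]
  simp_rw [hsum]
  simp

lemma sum_weight_card_monoSets {w : Bool → ℝ} (hw : ∑ b, w b = 1) (b : Bool) (j : ℕ) :
    ∑ f : Sym2 V → Bool, (∏ e, w (f e)) * (#(monoSets f b j) : ℝ) =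
      (Fintype.card V).choose j * w b ^ j.choose 2 := by
  simp_rw [monoSets, card_filter, Nat.cast_sum, mul_sum, Nat.cast_ite, Nat.cast_one, Nat.cast_zero]
  rw [sum_comm]
  simp_rw [sum_weight_forall_mem hw, card_distinctPairs]
  rw [sum_congr rfl (g := fun _ ↦ w b ^ j.choose 2) fun s hs ↦ by rw [(mem_powersetCard.1 hs).2]]
  simp

lemma cliqueCount_graphOf_le (f : Sym2 V → Bool) (j : ℕ) :
    cliqueCount (graphOf f) j ≤ #(monoSets f true j) := by
  rw [cliqueCount, ← Nat.card_eq_finsetCard]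
  refine Nat.card_le_card_of_injective
    (fun s ↦ (⟨s.1, ?_⟩ : {s // s ∈ monoSets f true j})) fun s t h ↦ ?_
  · simp only [monoSets, mem_filter, mem_powersetCard, forall_mem_distinctPairs]
    exact ⟨⟨subset_univ _, s.2.1⟩, fun u hu v hv huv ↦ (graphOf_adj.1 (s.2.2 hu hv huv)).1⟩
  · exact Subtype.ext (congrArg (fun x : {s // s ∈ monoSets f true j} ↦ x.1) h)

lemma edgeCount_graphOf_le (f : Sym2 V → Bool) :
    edgeCount (graphOf f) ≤ #(monoSets f true 2) := by
  rw [edgeCount, ← Set.ncard_coe_finset]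
  refine Set.ncard_le_ncard_of_injOn Sym2.toFinset ?_ ?_ (Set.toFinite _)
  · intro e
    induction e with | _ u v
    intro h
    rw [SimpleGraph.mem_edgeSet, graphOf_adj] at h
    simp only [monoSets, mem_coe, mem_filter, mem_powersetCard, forall_mem_distinctPairs,
      Sym2.toFinset_mk_eq]
    refine ⟨⟨subset_univ _, card_pair h.2⟩, ?_⟩
    have := @Sym2.eq_swap V u v
    grind
  · intro e _ e' _ h
    refine Sym2.ext fun x ↦ ?_
    rw [← Sym2.mem_toFinset, h, Sym2.mem_toFinset]

lemma indepBound_graphOf {f : Sym2 V → Bool} {k : ℕ} (h : monoSets f false (k + 1) = ∅) :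
    IndepBound (graphOf f) k := by
  intro s hs
  by_contra! hk
  obtain ⟨t, hts, ht⟩ := exists_subset_card_eq (Nat.succ_le_of_lt hk)
  have : t ∈ monoSets f false (k + 1) := by
    simp only [monoSets, mem_filter, mem_powersetCard, forall_mem_distinctPairs]
    refine ⟨⟨subset_univ _, ht⟩, fun u hu v hv huv ↦ ?_⟩
    have := hs u (hts hu) v (hts hv) huv
    rw [graphOf_adj] at this
    simpa [huv] using this
  simp [h] at this

/-- First moment method for graphs with small independence number and few edges and triangles. -/
theorem exists_indepBound_edgeCount_add_cliqueCount_lt {p T : ℝ} (hp₀ : 0 ≤ p) (hp₁ : p ≤ 1)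
    (hT : 0 ≤ T) (k : ℕ)
    (h : (Fintype.card V).choose 2 * p + (Fintype.card V).choose 3 * p ^ 3 +
      T * ((Fintype.card V).choose (k + 1) * (1 - p) ^ (k + 1).choose 2) < T) :
    ∃ G : SimpleGraph V, IndepBound G k ∧ (edgeCount G : ℝ) + cliqueCount G 3 < T := by
  set w : Bool → ℝ := fun b ↦ if b then p else 1 - p
  have hw : ∑ b, w b = 1 := by simp [w]
  have hw₀ (f : Sym2 V → Bool) : 0 ≤ ∏ e, w (f e) :=
    prod_nonneg fun e _ ↦ by simp only [w]; split_ifs <;> linarith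
  have hw₁ : ∑ f : Sym2 V → Bool, ∏ e, w (f e) = 1 := by
    simpa using sum_weight_forall_mem hw (∅ : Finset (Sym2 V)) true
  obtain ⟨f, hf⟩ : ∃ f : Sym2 V → Bool, (#(monoSets f true 2) : ℝ) + #(monoSets f true 3) +
      T * #(monoSets f false (k + 1)) < T := by
    by_contra! hcon
    have hle := sum_le_sum fun f (_ : f ∈ univ) ↦ mul_le_mul_of_nonneg_left (hcon f) (hw₀ f)
    rw [← sum_mul, hw₁, one_mul] at hle
    simp_rw [mul_add, sum_add_distrib, mul_left_comm _ T, ← mul_sum,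
      sum_weight_card_monoSets hw] at hle
    have h₂ : Nat.choose 2 2 = 1 := rfl
    have h₃ : Nat.choose 3 2 = 3 := rfl
    simp only [w, h₂, h₃, pow_one, if_true, Bool.false_eq_true, if_false] at hle
    linarith
  refine ⟨graphOf f, indepBound_graphOf ?_, ?_⟩
  · by_contra hne
    have : (1 : ℝ) ≤ #(monoSets f false (k + 1)) := by
      exact_mod_cast card_pos.2 (nonempty_iff_ne_empty.2 hne)
    nlinarith
  · have h₂ : (edgeCount (graphOf f) : ℝ) ≤ #(monoSets f true 2) := by
      exact_mod_cast edgeCount_graphOf_le f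
    have h₃ : (cliqueCount (graphOf f) 3 : ℝ) ≤ #(monoSets f true 3) := by
      exact_mod_cast cliqueCount_graphOf_le f 3
    have : 0 ≤ T * #(monoSets f false (k + 1)) := by positivity
    linarith

end RandomGraph

lemma choose_mul_div_pow_le {m k a b N r : ℕ} (hb : 0 < b) (hN : 0 < N)
    (h : N * m.descFactorial k * a ^ r ≤ k.factorial * b ^ r) :
    (m.choose k : ℝ) * ((a : ℝ) / b) ^ r ≤ 1 / N := by
  rw [Nat.descFactorial_eq_factorial_mul_choose, mul_left_comm, mul_assoc] at h
  have h' := Nat.le_of_mul_le_mul_left h k.factorial_pos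
  rify at h'
  rw [div_pow, ← mul_div_assoc, div_le_div_iff₀ (by positivity) (by positivity)]
  linarith

set_option exponentiation.threshold 10000 in
lemma pow_2073_le : (1 - 1291 / 250000 : ℝ) ^ 2073 ≤ (437 : ℕ) / (20000000 : ℕ) := by norm_num

set_option exponentiation.threshold 10000 in
lemma descFactorial_mul_pow_le :
    500 * Nat.descFactorial 164000 2074 * 437 ^ 1037 ≤
      Nat.factorial 2074 * 20000000 ^ 1037 := by
  norm_num [Nat.factorial, Nat.descFactorial]

lemma expected_indepSets_le :
    ((164000 : ℕ).choose 2074 : ℝ) * (1 - 1291 / 250000) ^ (2074 : ℕ).choose 2 ≤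
      1 / (500 : ℕ) := by
  have hexp : (2074 : ℕ).choose 2 = 2073 * 1037 := by norm_num [Nat.choose_two_right]
  rw [hexp, pow_mul]
  refine le_trans (mul_le_mul_of_nonneg_left ?_ (Nat.cast_nonneg _))
    (choose_mul_div_pow_le (by norm_num) (by norm_num) descFactorial_mul_pow_le)
  exact pow_le_pow_left₀ (pow_nonneg (by norm_num) _) pow_2073_le _

/-- There is a positive integer m and a graph G on m vertices with no independent set
of size 2074 such that e(G) + t₃(G) < m³/(6·2073²) − m/6. -/
theorem suitable_graph_exists :
    ∃ m : ℕ, 0 < m ∧ ∃ G : SimpleGraph (Fin m), IndepBound G 2073 ∧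
      ((edgeCount G : ℝ) + (cliqueCount G 3 : ℝ) <
        (m : ℝ) ^ 3 / (6 * 2073 ^ 2) - (m : ℝ) / 6) := by
  refine ⟨164000, by norm_num, ?_⟩
  refine exists_indepBound_edgeCount_add_cliqueCount_lt (p := 1291 / 250000)
    (by norm_num) (by norm_num) (by norm_num) 2073 ?_
  rw [Fintype.card_fin]
  have h₂ : (164000 : ℕ).choose 2 = 13447918000 := by
    norm_num [Nat.choose_two_right]
  have h₃ : (164000 : ℕ).choose 3 = 735143885388000 := by
    rw [Nat.choose_eq_descFactorial_div_factorial]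
    norm_num [Nat.factorial, Nat.descFactorial]
  have h := expected_indepSets_le
  rw [h₂, h₃]
  refine lt_of_le_of_lt (add_le_add_right (mul_le_mul_of_nonneg_left h (by norm_num)) _) ?_
  norm_num
end
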